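/- arXiv:2310.20053 — 5 statements merged into one kernel-verified Lean document; each statement's English description precedes it below -/
import Mathlib

section
/- (Maurer/Seeger kl PAC-Bayes bound, Theorem 2.1, Eq. (1).) Fix a measurable loss l : W × Z → [0,1], a sample size n ≥ 1 (in fact n ≥ 8 for the constant 2√n, but state as the paper does with log(2√n/δ)), a confidence level δ ∈ (0,1), and a data-free (prior) probability measure P on W. Then with probability at least 1−δ over the draw of S = (z₁,…,zₙ) i.i.d. from D, simultaneously for all probability measures Q on W: kl(L̂_S(Q) ∥ L(Q)) ≤ (KL(Q∥P) + log(2√n/δ)) / n. -/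
open MeasureTheory Real ENNReal Classical

/-- KL divergence between Bernoulli(q) and Bernoulli(p), with the conventions
`0 * log 0 = 0` and value `⊤` when `p ∈ {0,1}` and `q ≠ p`. -/
noncomputable def bernKL (q p : ℝ) : ℝ≥0∞ :=
  if (p = 0 ∧ q ≠ 0) ∨ (p = 1 ∧ q ≠ 1) then ⊤
  else ENNReal.ofReal (q * Real.log (q / p) + (1 - q) * Real.log ((1 - q) / (1 - p)))

/-- KL divergence between probability measures, `⊤` when `Q` is not absolutely
continuous with respect to `P` (or the log-likelihood ratio is not integrable). -/
noncomputable def KLdiv {W : Type*} [MeasurableSpace W] (Q P : Measure W) : ℝ≥0∞ :=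
  if Q ≪ P ∧ Integrable (llr Q P) Q then ENNReal.ofReal (∫ w, llr Q P w ∂Q) else ⊤

/-- `∑_{k=1}^{n-1} 1 / √(k (n - k)) ≤ π`, by comparison with `arcsin`. -/
lemma sum_inv_sqrt_mul_sub_le_pi (n : ℕ) :
    ∑ k ∈ Finset.range (n - 1), 1 / √(((k + 1 : ℕ) : ℝ) * (n - (k + 1 : ℕ))) ≤ π := by
  rcases Nat.lt_or_ge n 2 with hn | hn
  · have : n - 1 = 0 := by omega
    simp [this, pi_pos.le]
  have hn0 : (0 : ℝ) < n := by positivity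
  set θ : ℝ → ℝ := fun x => arcsin (2 * x / n - 1)
  have hmono : Monotone θ := fun x y hxy => monotone_arcsin (by gcongr)
  have key : ∀ a : ℝ, 0 ≤ a → a + 1 ≤ n →
      ∃ c ∈ Set.Ioo a (a + 1), θ (a + 1) - θ a = 1 / √(c * (n - c)) := by
    intro a ha han
    obtain ⟨c, hc, h⟩ := exists_hasDerivAt_eq_slope θ (fun c => 1 / √(c * (n - c)))
      (by linarith : a < a + 1) (by fun_prop) (by
        intro x hx
        have hx0 : 0 < x := ha.trans_lt hx.1
        have hxn : x < n := hx.2.trans_le han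
        have hpos : 0 < x * (n - x) := mul_pos hx0 (by linarith)
        have h1 : 2 * x / n - 1 ≠ -1 := by
          have : 0 < 2 * x / n := by positivity
          linarith
        have h2 : 2 * x / n - 1 ≠ 1 := by
          have : 2 * x / n < 2 := by rw [div_lt_iff₀ hn0]; linarith
          linarith
        have hd : HasDerivAt (fun x : ℝ => 2 * x / n - 1) (2 / n) x := by
          simpa using (((hasDerivAt_id x).const_mul 2).div_const (n : ℝ)).sub_const 1
        convert! (hasDerivAt_arcsin h1 h2).comp x hd using 1
        have : 1 - (2 * x / n - 1) ^ 2 = x * (n - x) * (2 / n) ^ 2 := by field_simp; ring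
        rw [this, sqrt_mul hpos.le, sqrt_sq (by positivity)]
        field_simp)
    refine ⟨c, hc, ?_⟩
    rw [h]; ring
  have hstep : ∀ k ∈ Finset.range (n - 1), 1 / √(((k + 1 : ℕ) : ℝ) * (n - (k + 1 : ℕ))) ≤
      (if 2 * (k + 1) ≤ n then θ (k + 1 : ℕ) else θ ((k + 1 : ℕ) + 1)) -
        (if 2 * k ≤ n then θ k else θ ((k : ℕ) + 1)) := by
    intro k hk
    have hk' : k + 2 ≤ n := by have := Finset.mem_range.mp hk; omega
    have hkr : (k : ℝ) + 2 ≤ n := by exact_mod_cast hk'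
    have hk0 : (0 : ℝ) ≤ k := by positivity
    push_cast
    by_cases h : 2 * (k + 1) ≤ n
    · have hr : 2 * ((k : ℝ) + 1) ≤ n := by exact_mod_cast h
      rw [if_pos h, if_pos (by omega)]
      obtain ⟨c, hc, he⟩ := key k hk0 (by linarith)
      rw [he]
      have : 0 < c * (n - c) := mul_pos (by linarith [hc.1]) (by linarith [hc.2])
      gcongr 1 / √?_
      nlinarith [mul_nonneg (by linarith [hc.2] : 0 ≤ (k : ℝ) + 1 - c)
        (by linarith [hc.2] : 0 ≤ n - (k + 1) - c)]
    · have hr : (n : ℝ) ≤ 2 * ((k : ℝ) + 1) := by exact_mod_cast (not_le.mp h).le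
      rw [if_neg h]
      obtain ⟨c, hc, he⟩ := key (k + 1) (by linarith) (by linarith)
      have hle : (if 2 * k ≤ n then θ k else θ ((k : ℕ) + 1)) ≤ θ (k + 1) := by
        split_ifs
        · exact hmono (by linarith)
        · exact le_rfl
      refine le_trans ?_ (sub_le_sub_left hle _)
      rw [he]
      have : 0 < c * (n - c) := mul_pos (by linarith [hc.1]) (by linarith [hc.2])
      gcongr 1 / √?_
      nlinarith [mul_nonneg (by linarith [hc.1] : 0 ≤ c - ((k : ℝ) + 1))
        (by linarith [hc.1] : 0 ≤ c - (n - (k + 1)))]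
  refine (Finset.sum_le_sum hstep).trans ?_
  rw [Finset.sum_range_sub (fun k : ℕ => if 2 * k ≤ n then θ k else θ (k + 1))]
  have hub : ∀ x, θ x ≤ π / 2 := fun x => arcsin_le_pi_div_two _
  have hlb : ∀ x, -(π / 2) ≤ θ x := fun x => neg_pi_div_two_le_arcsin _
  split_ifs <;> exact (sub_le_sub (hub _) (hlb _)).trans (by linarith)

lemma factorial_eq_stirlingSeq_mul {n : ℕ} (hn : n ≠ 0) :
    (n.factorial : ℝ) = Stirling.stirlingSeq n * (√(2 * n) * (n / exp 1) ^ n) := by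
  have : (0 : ℝ) < n := by positivity
  rw [Stirling.stirlingSeq, div_mul_cancel₀ _ (by positivity)]

/-- Stirling bound on the probability that a binomial variable with mean `k` equals `k`. -/
lemma choose_mul_pow_le_div_sqrt {n k : ℕ} (hk : k ≠ 0) (hkn : k < n) :
    (n.choose k : ℝ) * ((k / n : ℝ) ^ k * (1 - k / n : ℝ) ^ (n - k)) ≤
      √(n / (2 * π)) * (1 / √((k : ℝ) * (n - k))) := by
  obtain ⟨j, rfl⟩ : ∃ j, n = k + j := ⟨n - k, by omega⟩
  have hj : j ≠ 0 := by omega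
  have hk0 : (0 : ℝ) < k := by positivity
  have hj0 : (0 : ℝ) < j := by positivity
  have hfac := Nat.choose_mul_factorial_mul_factorial (Nat.le_add_right k j)
  rw [Nat.add_sub_cancel_left] at hfac
  have hfac' : ((k + j).choose k : ℝ) * k.factorial * j.factorial = (k + j).factorial := by
    exact_mod_cast hfac
  rw [factorial_eq_stirlingSeq_mul hk, factorial_eq_stirlingSeq_mul hj,
    factorial_eq_stirlingSeq_mul (by omega : k + j ≠ 0)] at hfac'
  have hs : Stirling.stirlingSeq (k + j) ≤ Stirling.stirlingSeq k := by
    obtain ⟨k, rfl⟩ := Nat.exists_eq_succ_of_ne_zero hk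
    have := Stirling.stirlingSeq'_antitone (show k ≤ k + j by omega)
    simpa [Nat.succ_eq_add_one, add_right_comm] using this
  have hsk := Stirling.sqrt_pi_le_stirlingSeq hk
  have hsj := Stirling.sqrt_pi_le_stirlingSeq hj
  have hπ : 0 < √π := by positivity
  set s := Stirling.stirlingSeq (k + j)
  set a := Stirling.stirlingSeq k
  set b := Stirling.stirlingSeq j
  have ha : 0 < a := hπ.trans_le hsk
  have hb : 0 < b := hπ.trans_le hsj
  have hsub : (1 - k / (k + j : ℕ) : ℝ) = j / (k + j) := by push_cast; field_simp; ring
  have hch : ((k + j).choose k : ℝ) * ((k / (k + j : ℕ) : ℝ) ^ k *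
      (1 - k / (k + j : ℕ) : ℝ) ^ (k + j - k)) =
        s * √(2 * (k + j)) / (a * b * (√(2 * k) * √(2 * j))) := by
    rw [_root_.eq_div_iff (by positivity), hsub, Nat.add_sub_cancel_left]
    push_cast at hfac' ⊢
    have he : (0 : ℝ) < exp 1 := exp_pos 1
    simp only [div_pow, pow_add] at hfac' ⊢
    field_simp at hfac' ⊢
    linear_combination hfac'
  rw [hch]
  have hsq : √((k + j : ℕ) / (2 * π)) * (1 / √((k : ℝ) * ((k + j : ℕ) - k))) =
      √(2 * (k + j)) / (√π * (√(2 * k) * √(2 * j))) := by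
    push_cast
    rw [add_sub_cancel_left, ← sqrt_mul (by positivity), ← sqrt_mul (by positivity),
      ← sqrt_div (by positivity), ← sqrt_one, ← sqrt_div (by positivity),
      ← sqrt_mul (by positivity)]
    congr 1
    field_simp
  rw [hsq, div_le_div_iff₀ (by positivity) (by positivity)]
  have : s * √π ≤ a * b := mul_le_mul hs hsj hπ.le ha.le
  have hnn : 0 ≤ √(2 * ((k : ℝ) + j)) * (√(2 * k) * √(2 * j)) := by positivity
  nlinarith [mul_le_mul_of_nonneg_right this hnn]

/-- Maurer's bound on `∑ₖ C(n,k) (k/n)ᵏ (1 - k/n)ⁿ⁻ᵏ`. -/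
lemma sum_choose_mul_pow_le_two_mul_sqrt {n : ℕ} (hn : 1 ≤ n) :
    ∑ k ∈ Finset.range (n + 1), (n.choose k : ℝ) * ((k / n : ℝ) ^ k * (1 - k / n : ℝ) ^ (n - k))
      ≤ 2 * √n := by
  rcases Nat.lt_or_ge n 8 with h8 | h8
  · rw [← div_le_iff₀' two_pos]
    apply le_sqrt_of_sq_le
    interval_cases n <;> norm_num [Finset.sum_range_succ, Nat.choose]
  · have hn0 : (0 : ℝ) < n := by positivity
    obtain ⟨m, rfl⟩ : ∃ m, n = m + 1 := ⟨n - 1, by omega⟩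
    rw [Finset.sum_range_succ, Finset.sum_range_succ']
    have hmid : ∑ k ∈ Finset.range m, ((m + 1).choose (k + 1) : ℝ) *
        (((k + 1 : ℕ) / (m + 1 : ℕ) : ℝ) ^ (k + 1) *
          (1 - (k + 1 : ℕ) / (m + 1 : ℕ) : ℝ) ^ (m + 1 - (k + 1))) ≤
        √((m + 1 : ℕ) / (2 * π)) * π := by
      refine (Finset.sum_le_sum fun k hk => choose_mul_pow_le_div_sqrt (Nat.succ_ne_zero k)
        (by have := Finset.mem_range.mp hk; omega)).trans ?_
      rw [← Finset.mul_sum]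
      exact mul_le_mul_of_nonneg_left (sum_inv_sqrt_mul_sub_le_pi (m + 1)) (sqrt_nonneg _)
    have hconst : √((m + 1 : ℕ) / (2 * π)) * π ≤ 1.26 * √(m + 1 : ℕ) := by
      have : √((m + 1 : ℕ) / (2 * π)) * π = √(π / 2) * √(m + 1 : ℕ) := by
        rw [← sqrt_mul (by positivity)]
        nth_rewrite 2 [← sqrt_sq pi_pos.le]
        rw [← sqrt_mul (by positivity)]
        congr 1
        field_simp
      rw [this]
      gcongr
      rw [sqrt_le_left (by norm_num)]
      linarith [pi_lt_d2]
    have h28 : 2.8 ≤ √((m + 1 : ℕ) : ℝ) := by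
      apply le_sqrt_of_sq_le
      have : (8 : ℝ) ≤ (m + 1 : ℕ) := by exact_mod_cast h8
      norm_num at this ⊢
      linarith
    have hself : ((m + 1 : ℕ) : ℝ) / (m + 1 : ℕ) = 1 := div_self hn0.ne'
    simp only [hself, Nat.choose_self, Nat.choose_zero_right, Nat.sub_self, pow_zero, one_pow,
      Nat.cast_one, CharP.cast_eq_zero, zero_div, sub_zero, mul_one]
    linarith

/-- The real-valued KL divergence between Bernoulli distributions, set to `0` when the second
parameter lies outside `(0, 1)`. -/
noncomputable def interiorBernKL (q p : ℝ) : ℝ :=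
  if p ∈ Set.Ioo (0 : ℝ) 1 then q * Real.log (q / p) + (1 - q) * Real.log ((1 - q) / (1 - p)) else 0

lemma mul_log_div_ge {q p q₀ p₀ : ℝ} (hq : 0 ≤ q) (hp : 0 ≤ p) (hq₀ : 0 ≤ q₀) (hp₀ : 0 < p₀)
    (h : p = 0 → q = 0) (h₀ : q₀ = 0 → q = 0) :
    q * Real.log (q₀ / p₀) + q - p * (q₀ / p₀) ≤ q * Real.log (q / p) := by
  rcases hq.eq_or_lt with rfl | hq'
  · have : 0 ≤ p * (q₀ / p₀) := by positivity
    simpa using this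
  have hp' : 0 < p := hp.lt_of_ne fun e => hq'.ne' (h e.symm)
  have hq₀' : 0 < q₀ := hq₀.lt_of_ne fun e => hq'.ne' (h₀ e.symm)
  have hlog := log_le_sub_one_of_pos (show 0 < q₀ / p₀ / (q / p) by positivity)
  rw [log_div (by positivity) (by positivity)] at hlog
  have hm := mul_le_mul_of_nonneg_left hlog hq
  have : q * (q₀ / p₀ / (q / p) - 1) = p * (q₀ / p₀) - q := by field_simp
  linarith

lemma interiorBernKL_nonneg {q : ℝ} (hq : q ∈ Set.Icc (0 : ℝ) 1) (p : ℝ) :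
    0 ≤ interiorBernKL q p := by
  unfold interiorBernKL
  split_ifs with hp
  · have h1 := mul_log_div_ge hq.1 hp.1.le hp.1.le hp.1 (fun e => absurd e hp.1.ne')
      (fun e => absurd e hp.1.ne')
    have hp1 : 0 < 1 - p := sub_pos.2 hp.2
    have h2 := mul_log_div_ge (sub_nonneg.2 hq.2) hp1.le hp1.le hp1 (fun e => absurd e hp1.ne')
      (fun e => absurd e hp1.ne')
    rw [div_self hp.1.ne', Real.log_one] at h1
    rw [div_self hp1.ne', Real.log_one] at h2
    linarith
  · exact le_rfl

/-- The tangent plane at `(q₀, p₀)` of the Bernoulli KL divergence. -/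
noncomputable def bernKLTangent (q₀ p₀ q p : ℝ) : ℝ :=
  q * Real.log (q₀ / p₀) + q - p * (q₀ / p₀) +
    ((1 - q) * Real.log ((1 - q₀) / (1 - p₀)) + (1 - q) - (1 - p) * ((1 - q₀) / (1 - p₀)))

lemma bernKLTangent_le_interiorBernKL {q p q₀ p₀ : ℝ} (hq : q ∈ Set.Icc (0 : ℝ) 1)
    (hp : p ∈ Set.Icc (0 : ℝ) 1) (hq₀ : q₀ ∈ Set.Icc (0 : ℝ) 1) (hp₀ : p₀ ∈ Set.Ioo (0 : ℝ) 1)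
    (h0 : p = 0 → q = 0) (h1 : p = 1 → q = 1) (h0' : q₀ = 0 → q = 0) (h1' : q₀ = 1 → q = 1) :
    bernKLTangent q₀ p₀ q p ≤ interiorBernKL q p := by
  have e1 := mul_log_div_ge hq.1 hp.1 hq₀.1 hp₀.1 h0 h0'
  have e2 := mul_log_div_ge (sub_nonneg.2 hq.2) (sub_nonneg.2 hp.2) (sub_nonneg.2 hq₀.2)
    (sub_pos.2 hp₀.2) (fun e => by rw [h1 (by linarith)]; norm_num)
    (fun e => by rw [h1' (by linarith)]; norm_num)
  refine (add_le_add e1 e2).trans ?_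
  unfold interiorBernKL
  split_ifs with hpi
  · exact le_rfl
  · rcases hp.1.eq_or_lt with rfl | hp0
    · simp [h0 rfl]
    · have : p = 1 := le_antisymm hp.2 (not_lt.1 fun h => hpi ⟨hp0, h⟩)
      subst this
      simp [h1 rfl]

lemma abs_bernKLTangent_le {q p : ℝ} (q₀ p₀ : ℝ) (hq : q ∈ Set.Icc (0 : ℝ) 1)
    (hp : p ∈ Set.Icc (0 : ℝ) 1) :
    |bernKLTangent q₀ p₀ q p| ≤ |Real.log (q₀ / p₀)| + 1 + |q₀ / p₀| +
      (|Real.log ((1 - q₀) / (1 - p₀))| + 1 + |(1 - q₀) / (1 - p₀)|) := by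
  have aux : ∀ a b x y : ℝ, x ∈ Set.Icc (0 : ℝ) 1 → y ∈ Set.Icc (0 : ℝ) 1 →
      |x * a + x - y * b| ≤ |a| + 1 + |b| := by
    intro a b x y hx hy
    have h1 : |x * a| ≤ |a| := by
      rw [abs_mul, abs_of_nonneg hx.1]; exact mul_le_of_le_one_left (abs_nonneg _) hx.2
    have h2 : |y * b| ≤ |b| := by
      rw [abs_mul, abs_of_nonneg hy.1]; exact mul_le_of_le_one_left (abs_nonneg _) hy.2
    have h3 : |x| ≤ 1 := by rw [abs_of_nonneg hx.1]; exact hx.2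
    exact (abs_sub _ _).trans (add_le_add ((abs_add_le _ _).trans (add_le_add h1 h3)) h2)
  exact (abs_add_le _ _).trans (add_le_add (aux _ _ _ _ hq hp)
    (aux _ _ _ _ ⟨sub_nonneg.2 hq.2, sub_le_self _ hq.1⟩ ⟨sub_nonneg.2 hp.2, sub_le_self _ hp.1⟩))

lemma bernKLTangent_self {q p : ℝ} (hp : p ∈ Set.Ioo (0 : ℝ) 1) :
    bernKLTangent q p q p = q * Real.log (q / p) + (1 - q) * Real.log ((1 - q) / (1 - p)) := by
  have h1 := hp.1.ne'
  have h2 := (sub_pos.2 hp.2).ne'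
  rw [bernKLTangent, mul_div_cancel₀ _ h1, mul_div_cancel₀ _ h2]
  ring

lemma integral_bernKLTangent {W : Type*} [MeasurableSpace W] {Q : Measure W}
    [IsProbabilityMeasure Q] {q p : W → ℝ} (hq : Integrable q Q) (hp : Integrable p Q)
    (q₀ p₀ : ℝ) :
    ∫ w, bernKLTangent q₀ p₀ (q w) (p w) ∂Q =
      bernKLTangent q₀ p₀ (∫ w, q w ∂Q) (∫ w, p w ∂Q) := by
  have h : ∀ x y : ℝ, bernKLTangent q₀ p₀ x y =
      (Real.log (q₀ / p₀) - Real.log ((1 - q₀) / (1 - p₀))) * x +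
        ((1 - q₀) / (1 - p₀) - q₀ / p₀) * y +
        (Real.log ((1 - q₀) / (1 - p₀)) + 1 - (1 - q₀) / (1 - p₀)) := by
    intro x y; unfold bernKLTangent; ring
  simp only [h]
  rw [integral_add (f := fun w => _ * q w + _ * p w) ((hq.const_mul _).add (hp.const_mul _))
      (integrable_const _),
    integral_add (hq.const_mul _) (hp.const_mul _), integral_const_mul, integral_const_mul]
  simp

lemma bernKL_eq_ofReal {q p : ℝ} (hp : p ∈ Set.Ioo (0 : ℝ) 1) :
    bernKL q p = ENNReal.ofReal (bernKLTangent q p q p) := by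
  rw [bernKL, if_neg (by simp [hp.1.ne', hp.2.ne]), bernKLTangent_self hp]

lemma convexOn_exp_mul_interiorBernKL (n : ℕ) (p : ℝ) :
    ConvexOn ℝ (Set.Icc (0 : ℝ) 1) fun q => exp (n * interiorBernKL q p) := by
  by_cases hp : p ∈ Set.Ioo (0 : ℝ) 1
  swap
  · simpa [interiorBernKL, hp] using convexOn_const (1 : ℝ) (convex_Icc (0 : ℝ) 1)
  have hp1 : 0 < 1 - p := sub_pos.2 hp.2
  have hlin : ConvexOn ℝ (Set.Icc (0 : ℝ) 1) fun q => q * (Real.log (1 - p) - Real.log p) :=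
    ((LinearMap.mulRight ℝ (Real.log (1 - p) - Real.log p)).convexOn (convex_Icc (0 : ℝ) 1))
  have hkl : ConvexOn ℝ (Set.Icc (0 : ℝ) 1) fun q => interiorBernKL q p := by
    refine ((strictConcave_binEntropy.concaveOn.neg.add hlin).add
      (convexOn_const (-Real.log (1 - p)) (convex_Icc (0 : ℝ) 1))).congr fun q hq => ?_
    have h : ∀ a b : ℝ, 0 < b → a * Real.log (a / b) = a * Real.log a - a * Real.log b := by
      intro a b hb
      rcases eq_or_ne a 0 with rfl | ha
      · simp
      · rw [log_div ha hb.ne']; ring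
    simp only [interiorBernKL, if_pos hp, h q p hp.1, h (1 - q) (1 - p) hp1,
      binEntropy_eq_negMulLog_add_negMulLog_one_sub, negMulLog, Pi.add_apply, Pi.neg_apply]
    ring
  have hnkl := hkl.smul (c := (n : ℝ)) n.cast_nonneg
  exact ⟨hnkl.1, fun x hx y hy a b ha hb hab => (exp_le_exp.2 (hnkl.2 hx hy ha hb hab)).trans
    (convexOn_exp.2 trivial trivial ha hb hab)⟩

lemma exp_mul_interiorBernKL_div {n k : ℕ} (hn : n ≠ 0) (hk : k ≤ n) {p : ℝ}
    (hp : p ∈ Set.Ioo (0 : ℝ) 1) :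
    p ^ k * (1 - p) ^ (n - k) * exp (n * interiorBernKL (k / n) p) =
      (k / n : ℝ) ^ k * (1 - k / n : ℝ) ^ (n - k) := by
  have hn0 : (0 : ℝ) < n := by positivity
  have h : ∀ (m : ℕ) (b : ℝ), 0 < b →
      b ^ m * exp (m * Real.log ((m / n : ℝ) / b)) = (m / n : ℝ) ^ m := by
    intro m b hb
    rcases eq_or_ne m 0 with rfl | hm
    · simp
    · rw [mul_comm (m : ℝ), exp_mul, exp_log (by positivity), Real.rpow_natCast, ← mul_pow,
        mul_div_cancel₀ _ hb.ne']
  have hsub : (1 - k / n : ℝ) = (n - k : ℕ) / n := by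
    rw [Nat.cast_sub hk]; field_simp
  have hcancel : ∀ a c : ℝ, n * (a / n * c) = a * c := by intro a c; field_simp
  rw [interiorBernKL, if_pos hp, hsub, ← h k p hp.1, ← h (n - k) (1 - p) (sub_pos.2 hp.2), mul_add,
    exp_add, hcancel, hcancel]
  ring

/-- Jensen's inequality for the product Bernoulli measure with means `x i`: a convex function of
the mean of `x` is at most the expectation of that function of the empirical frequency. -/
lemma ConvexOn.map_mean_le_sum_powerset {n : ℕ} (hn : n ≠ 0) {g : ℝ → ℝ}
    (hg : ConvexOn ℝ (Set.Icc (0 : ℝ) 1) g) {x : Fin n → ℝ} (hx : ∀ i, x i ∈ Set.Icc (0 : ℝ) 1) :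
    g ((n : ℝ)⁻¹ * ∑ i, x i) ≤
      ∑ t : Finset (Fin n), (∏ i, if i ∈ t then x i else 1 - x i) * g (t.card / n) := by
  have hn0 : (0 : ℝ) < n := by positivity
  have hprod : ∀ a b : Fin n → ℝ,
      ∑ t : Finset (Fin n), (∏ i, if i ∈ t then a i else b i) = ∏ i, (a i + b i) := by
    intro a b
    rw [Finset.prod_add, Finset.powerset_univ]
    refine Finset.sum_congr rfl fun t _ => ?_
    rw [Finset.prod_ite]
    congr 2 <;> ext <;> simp
  have hone : ∑ t : Finset (Fin n), (∏ i, if i ∈ t then x i else 1 - x i) = 1 := by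
    simp [hprod]
  have hmem : ∀ i, ∑ t : Finset (Fin n),
      (∏ j, if j ∈ t then x j else 1 - x j) * (if i ∈ t then 1 else 0) = x i := by
    intro i
    have h := hprod x (Function.update (fun j => 1 - x j) i 0)
    have hr : ∏ j, (x j + Function.update (fun j => 1 - x j) i 0 j) = x i := by
      rw [← Finset.mul_prod_erase _ _ (Finset.mem_univ i), Finset.prod_eq_one]
      · simp
      · intro j hj
        simp [Function.update_of_ne (Finset.ne_of_mem_erase hj)]
    rw [← hr, ← h]
    refine Finset.sum_congr rfl fun t _ => ?_
    by_cases hi : i ∈ t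
    · rw [if_pos hi, mul_one]
      refine Finset.prod_congr rfl fun j _ => ?_
      by_cases hj : j ∈ t
      · simp [hj]
      · have : j ≠ i := fun e => hj (e ▸ hi)
        simp [hj, Function.update_of_ne this]
    · rw [if_neg hi, mul_zero]
      exact (Finset.prod_eq_zero (Finset.mem_univ i) (by simp [hi])).symm
  have hmean : ∑ t : Finset (Fin n), (∏ i, if i ∈ t then x i else 1 - x i) • ((t.card : ℝ) / n) =
      (n : ℝ)⁻¹ * ∑ i, x i := by
    have hcard : ∀ t : Finset (Fin n), (t.card : ℝ) = ∑ i, if i ∈ t then (1 : ℝ) else 0 := by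
      intro t; simp
    rw [← Finset.sum_congr rfl fun i _ => hmem i, Finset.sum_comm, Finset.mul_sum]
    refine Finset.sum_congr rfl fun t _ => ?_
    rw [← Finset.mul_sum, ← hcard, smul_eq_mul]
    ring
  have hJ := hg.map_sum_le (t := (Finset.univ : Finset (Finset (Fin n))))
    (w := fun t => ∏ i, if i ∈ t then x i else 1 - x i) (p := fun t => (t.card : ℝ) / n)
    (fun t _ => Finset.prod_nonneg fun i _ => by
      split_ifs
      · exact (hx i).1
      · exact sub_nonneg.2 (hx i).2) hone
    (fun t _ => ⟨by positivity, by
      rw [div_le_one hn0]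
      exact_mod_cast t.card_le_univ.trans_eq (Fintype.card_fin n)⟩)
  rw [hmean] at hJ
  simpa only [smul_eq_mul] using hJ

/-- The exponential moment of the Bernoulli KL divergence between the empirical mean of an i.i.d.
`[0, 1]`-valued sample and its expectation is at most `2√n`. -/
lemma lintegral_exp_mul_interiorBernKL_le {Z : Type*} [MeasurableSpace Z] (D : Measure Z)
    [IsProbabilityMeasure D] {f : Z → ℝ} (hf : Measurable f)
    (hf01 : ∀ z, f z ∈ Set.Icc (0 : ℝ) 1) {n : ℕ} (hn : 1 ≤ n) :
    ∫⁻ S : Fin n → Z, ENNReal.ofReal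
        (exp (n * interiorBernKL ((n : ℝ)⁻¹ * ∑ i, f (S i)) (∫ z, f z ∂D)))
      ∂(Measure.pi fun _ => D) ≤ ENNReal.ofReal (2 * √n) := by
  set p := ∫ z, f z ∂D with hp_def
  have hint : Integrable f D := Integrable.of_bound hf.aestronglyMeasurable 1
    (ae_of_all _ fun z => by rw [norm_of_nonneg (hf01 z).1]; exact (hf01 z).2)
  by_cases hp : p ∈ Set.Ioo (0 : ℝ) 1
  swap
  · have h1 : (1 : ℝ) ≤ √n := one_le_sqrt.2 (by exact_mod_cast hn)
    simp only [interiorBernKL, if_neg hp, mul_zero, exp_zero, lintegral_const, measure_univ,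
      mul_one]
    exact ENNReal.ofReal_le_ofReal (by linarith)
  have hn0 : n ≠ 0 := by omega
  set g : ℝ → ℝ := fun q => exp (n * interiorBernKL q p)
  have hfac : ∀ (t : Finset (Fin n)) (i : Fin n),
      Integrable (fun z => if i ∈ t then f z else 1 - f z) D := by
    intro t i
    split_ifs
    · exact hint
    · exact (integrable_const 1).sub hint
  have hterm : ∀ t : Finset (Fin n), Integrable
      (fun S : Fin n → Z => (∏ i, if i ∈ t then f (S i) else 1 - f (S i)) * g (t.card / n))
      (Measure.pi fun _ => D) := fun t =>
    (Integrable.fintype_prod (f := fun i z => if i ∈ t then f z else 1 - f z)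
      (hfac t)).mul_const _
  have hval : ∀ t : Finset (Fin n), ∫ S : Fin n → Z,
      (∏ i, if i ∈ t then f (S i) else 1 - f (S i)) * g (t.card / n) ∂(Measure.pi fun _ => D) =
        (t.card / n : ℝ) ^ t.card * (1 - t.card / n : ℝ) ^ (n - t.card) := by
    intro t
    have ht : t.card ≤ n := t.card_le_univ.trans_eq (Fintype.card_fin n)
    rw [integral_mul_const,
      integral_fintype_prod_eq_prod (fun i z => if i ∈ t then f z else 1 - f z),
      ← exp_mul_interiorBernKL_div hn0 ht hp]
    congr 1
    have : ∀ i, ∫ z, (if i ∈ t then f z else 1 - f z) ∂D = if i ∈ t then p else 1 - p := by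
      intro i
      split_ifs
      · rfl
      · rw [integral_sub (integrable_const 1) hint]; simp [hp_def]
    simp only [this, Finset.prod_ite, Finset.prod_const]
    congr 2
    · simp
    · have : Finset.univ.filter (fun i => i ∉ t) = tᶜ := by ext; simp
      rw [this, Finset.card_compl, Fintype.card_fin]
  calc ∫⁻ S : Fin n → Z, ENNReal.ofReal (g ((n : ℝ)⁻¹ * ∑ i, f (S i))) ∂(Measure.pi fun _ => D)
      ≤ ∫⁻ S : Fin n → Z, ENNReal.ofReal (∑ t : Finset (Fin n),
          (∏ i, if i ∈ t then f (S i) else 1 - f (S i)) * g (t.card / n))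
          ∂(Measure.pi fun _ => D) :=
        lintegral_mono fun S => ENNReal.ofReal_le_ofReal
          ((convexOn_exp_mul_interiorBernKL n p).map_mean_le_sum_powerset hn0
            fun i => hf01 (S i))
    _ = ENNReal.ofReal (∫ S : Fin n → Z, ∑ t : Finset (Fin n),
          (∏ i, if i ∈ t then f (S i) else 1 - f (S i)) * g (t.card / n)
          ∂(Measure.pi fun _ => D)) := by
        rw [ofReal_integral_eq_lintegral_ofReal (integrable_finsetSum _ fun t _ => hterm t)]
        refine ae_of_all _ fun S => Finset.sum_nonneg fun t _ => mul_nonneg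
          (Finset.prod_nonneg fun i _ => ?_) (exp_nonneg _)
        split_ifs
        · exact (hf01 _).1
        · exact sub_nonneg.2 (hf01 _).2
    _ ≤ ENNReal.ofReal (2 * √n) := by
        rw [integral_finsetSum _ fun t _ => hterm t]
        simp only [hval]
        rw [← Finset.powerset_univ, Finset.sum_powerset_apply_card
          (fun k => (k / n : ℝ) ^ k * (1 - k / n : ℝ) ^ (n - k)), Finset.card_univ,
          Fintype.card_fin]
        simp only [nsmul_eq_mul]
        exact ENNReal.ofReal_le_ofReal (sum_choose_mul_pow_le_two_mul_sqrt hn)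

lemma measurable_interiorBernKL : Measurable fun x : ℝ × ℝ => interiorBernKL x.1 x.2 := by
  unfold interiorBernKL
  exact Measurable.ite (measurable_snd measurableSet_Ioo) (by fun_prop) measurable_const

lemma measurable_bernKLTangent (q₀ p₀ : ℝ) :
    Measurable fun x : ℝ × ℝ => bernKLTangent q₀ p₀ x.1 x.2 := by
  unfold bernKLTangent
  fun_prop

/-- The Donsker–Varadhan inequality for bounded functions. -/
lemma integral_le_integral_llr_add_log {W : Type*} [MeasurableSpace W] {Q P : Measure W}
    [IsProbabilityMeasure Q] [IsProbabilityMeasure P] (hQP : Q ≪ P)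
    (hint : Integrable (llr Q P) Q) {f : W → ℝ} (hf : Measurable f) {C : ℝ}
    (hC : ∀ w, |f w| ≤ C) :
    ∫ w, f w ∂Q ≤ ∫ w, llr Q P w ∂Q + Real.log (∫ w, exp (f w) ∂P) := by
  have hfQ : Integrable f Q := Integrable.of_bound hf.aestronglyMeasurable C (ae_of_all _ hC)
  have hfP : Integrable (fun w => exp (f w)) P :=
    Integrable.of_bound hf.exp.aestronglyMeasurable (exp C) (ae_of_all _ fun w => by
      rw [norm_of_nonneg (exp_nonneg _)]
      exact exp_le_exp.2 ((le_abs_self _).trans (hC w)))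
  have := isProbabilityMeasure_tilted hfP
  have h := InformationTheory.integral_llr_add_sub_measure_univ_nonneg
    (hQP.trans (absolutelyContinuous_tilted hfP)) (integrable_llr_tilted_right hQP hfQ hint hfP)
  rw [integral_llr_tilted_right hQP hfQ hfP hint] at h
  simp only [probReal_univ] at h
  linarith

lemma integral_mem_Icc {Ω : Type*} [MeasurableSpace Ω] {μ : Measure Ω} [IsProbabilityMeasure μ]
    {f : Ω → ℝ} (hf : Integrable f μ) (h : ∀ x, f x ∈ Set.Icc (0 : ℝ) 1) :
    ∫ x, f x ∂μ ∈ Set.Icc (0 : ℝ) 1 :=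
  ⟨integral_nonneg fun x => (h x).1, by
    simpa using integral_mono hf (integrable_const 1) fun x => (h x).2⟩

lemma ae_eq_zero_of_integral_eq_zero {Ω : Type*} [MeasurableSpace Ω] {μ : Measure Ω}
    {f : Ω → ℝ} (hf : Integrable f μ) (h : ∀ x, f x ∈ Set.Icc (0 : ℝ) 1)
    (h0 : ∫ x, f x ∂μ = 0) : ∀ᵐ x ∂μ, f x = 0 :=
  (integral_eq_zero_iff_of_nonneg (fun x => (h x).1) hf).1 h0

lemma ae_eq_one_of_integral_eq_one {Ω : Type*} [MeasurableSpace Ω] {μ : Measure Ω}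
    [IsProbabilityMeasure μ] {f : Ω → ℝ} (hf : Integrable f μ)
    (h : ∀ x, f x ∈ Set.Icc (0 : ℝ) 1) (h1 : ∫ x, f x ∂μ = 1) : ∀ᵐ x ∂μ, f x = 1 := by
  have := ae_eq_zero_of_integral_eq_zero ((integrable_const (1 : ℝ)).sub hf)
    (fun x => ⟨sub_nonneg.2 (h x).2, sub_le_self _ (h x).1⟩) (by
      simp only [Pi.sub_apply]
      rw [integral_sub (integrable_const 1) hf, h1]; simp)
  filter_upwards [this] with x hx
  simp only [Pi.sub_apply] at hx
  linarith

/-- Change of measure: a bound on the prior exponential moment of the Bernoulli KL divergence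
yields a bound on the Bernoulli KL divergence of the posterior averages. -/
lemma bernKL_integral_le {W : Type*} [MeasurableSpace W] {Q P : Measure W}
    [IsProbabilityMeasure Q] [IsProbabilityMeasure P] {q p : W → ℝ} (hq : Measurable q)
    (hp : Measurable p) (hq01 : ∀ w, q w ∈ Set.Icc (0 : ℝ) 1)
    (hp01 : ∀ w, p w ∈ Set.Icc (0 : ℝ) 1)
    (h0 : ∀ᵐ w ∂P, p w = 0 → q w = 0) (h1 : ∀ᵐ w ∂P, p w = 1 → q w = 1)
    {n : ℕ} (hn : n ≠ 0) {B : ℝ} (hB : 0 ≤ B)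
    (hM : ∫⁻ w, ENNReal.ofReal (exp (n * interiorBernKL (q w) (p w))) ∂P ≤ ENNReal.ofReal B) :
    bernKL (∫ w, q w ∂Q) (∫ w, p w ∂Q) ≤
      (KLdiv Q P + ENNReal.ofReal (Real.log B)) / (n : ℝ≥0∞) := by
  by_cases hKL : Q ≪ P ∧ Integrable (llr Q P) Q
  swap
  · simp [KLdiv, hKL, ENNReal.top_div]
  have hn0 : (0 : ℝ) < n := by positivity
  obtain ⟨hQP, hllr⟩ := hKL
  have hbdd : ∀ f : W → ℝ, Measurable f → (∀ w, f w ∈ Set.Icc (0 : ℝ) 1) → Integrable f Q :=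
    fun f hf h => Integrable.of_bound hf.aestronglyMeasurable 1
      (ae_of_all _ fun w => by rw [norm_of_nonneg (h w).1]; exact (h w).2)
  have hqi := hbdd q hq hq01
  have hpi := hbdd p hp hp01
  have hq₀ := integral_mem_Icc hqi hq01
  have hp₀ := integral_mem_Icc hpi hp01
  have h0Q := hQP.ae_le h0
  have h1Q := hQP.ae_le h1
  by_cases hp0 : ∫ w, p w ∂Q = 0
  · have : ∫ w, q w ∂Q = 0 := by
      refine integral_eq_zero_of_ae ?_
      filter_upwards [h0Q, ae_eq_zero_of_integral_eq_zero hpi hp01 hp0] with w h h' using h h'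
    simp [hp0, this, bernKL]
  by_cases hp1 : ∫ w, p w ∂Q = 1
  · have : ∫ w, q w ∂Q = 1 := by
      rw [integral_congr_ae (g := fun _ => (1 : ℝ))]
      · simp
      filter_upwards [h1Q, ae_eq_one_of_integral_eq_one hpi hp01 hp1] with w h h' using h h'
    simp [hp1, this, bernKL]
  have hp₀' : ∫ w, p w ∂Q ∈ Set.Ioo (0 : ℝ) 1 :=
    ⟨hp₀.1.lt_of_ne (Ne.symm hp0), hp₀.2.lt_of_ne hp1⟩
  rw [bernKL_eq_ofReal hp₀', ← integral_bernKLTangent hqi hpi]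
  set q₀ := ∫ w, q w ∂Q
  set p₀ := ∫ w, p w ∂Q
  set T : W → ℝ := fun w => bernKLTangent q₀ p₀ (q w) (p w)
  have hTm : Measurable T := (measurable_bernKLTangent q₀ p₀).comp (hq.prodMk hp)
  obtain ⟨C, hC⟩ : ∃ C, ∀ w, |T w| ≤ C :=
    ⟨_, fun w => abs_bernKLTangent_le q₀ p₀ (hq01 w) (hp01 w)⟩
  set f : W → ℝ := fun w => n * min (T w) (interiorBernKL (q w) (p w)) with hf
  have hfm : Measurable f :=
    (hTm.min (measurable_interiorBernKL.comp (hq.prodMk hp))).const_mul _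
  have hfC : ∀ w, |f w| ≤ n * C := by
    intro w
    rw [hf, abs_mul, Nat.abs_cast]
    have hG := interiorBernKL_nonneg (hq01 w) (p w)
    have hTw := abs_le.1 (hC w)
    have hC0 := (abs_nonneg _).trans (hC w)
    gcongr
    exact abs_le.2 ⟨le_min hTw.1 (by linarith), (min_le_left _ _).trans hTw.2⟩
  have hfT : ∫ w, f w ∂Q = n * ∫ w, T w ∂Q := by
    rw [← integral_const_mul]
    refine integral_congr_ae ?_
    have h0' : ∀ᵐ w ∂Q, q₀ = 0 → q w = 0 := by
      by_cases h : q₀ = 0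
      · filter_upwards [ae_eq_zero_of_integral_eq_zero hqi hq01 h] with w hw _ using hw
      · exact ae_of_all _ fun w e => absurd e h
    have h1' : ∀ᵐ w ∂Q, q₀ = 1 → q w = 1 := by
      by_cases h : q₀ = 1
      · filter_upwards [ae_eq_one_of_integral_eq_one hqi hq01 h] with w hw _ using hw
      · exact ae_of_all _ fun w e => absurd e h
    filter_upwards [h0Q, h1Q, h0', h1'] with w a b c d
    simp only [hf]
    rw [min_eq_left (bernKLTangent_le_interiorBernKL (hq01 w) (hp01 w) hq₀ hp₀' a b c d)]
  have hDV := integral_le_integral_llr_add_log hQP hllr hfm hfC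
  have hexp : Integrable (fun w => exp (f w)) P :=
    Integrable.of_bound hfm.exp.aestronglyMeasurable (exp (n * C)) (ae_of_all _ fun w => by
      rw [norm_of_nonneg (exp_nonneg _)]
      exact exp_le_exp.2 ((le_abs_self _).trans (hfC w)))
  have hle : ∫ w, exp (f w) ∂P ≤ B := by
    rw [integral_eq_lintegral_of_nonneg_ae (ae_of_all _ fun w => exp_nonneg _)
      hfm.exp.aestronglyMeasurable]
    refine ENNReal.toReal_le_of_le_ofReal hB (le_trans (lintegral_mono fun w => ?_) hM)
    refine ENNReal.ofReal_le_ofReal (exp_le_exp.2 ?_)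
    exact mul_le_mul_of_nonneg_left (min_le_right _ _) hn0.le
  have hlog := Real.log_le_log (integral_exp_pos hexp) hle
  have hfinal : ∫ w, T w ∂Q ≤ (∫ w, llr Q P w ∂Q + Real.log B) / n := by
    rw [le_div_iff₀' hn0, ← hfT]
    linarith
  rw [KLdiv, if_pos ⟨hQP, hllr⟩]
  calc ENNReal.ofReal (∫ w, T w ∂Q)
      ≤ ENNReal.ofReal ((∫ w, llr Q P w ∂Q + Real.log B) / n) := ENNReal.ofReal_le_ofReal hfinal
    _ = ENNReal.ofReal (∫ w, llr Q P w ∂Q + Real.log B) / (n : ℝ≥0∞) := by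
        rw [ENNReal.ofReal_div_of_pos hn0, ENNReal.ofReal_natCast]
    _ ≤ _ := ENNReal.div_le_div_right ENNReal.ofReal_add_le _

lemma ae_pi_of_ae {Z ι : Type*} [Fintype ι] [MeasurableSpace Z] {D : Measure Z}
    [IsProbabilityMeasure D] {r : Z → Prop} (h : ∀ᵐ z ∂D, r z) :
    ∀ᵐ S ∂(Measure.pi fun _ : ι => D), ∀ i, r (S i) :=
  ae_all_iff.2 fun i =>
    (measurePreserving_eval (fun _ : ι => D) i).quasiMeasurePreserving.ae h

/-- Maurer/Seeger kl PAC-Bayes bound: with probability at least `1 - δ` over the draw of an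
i.i.d. sample `S ∼ Dⁿ`, simultaneously for all posteriors `Q`,
`kl(L̂_S(Q) ‖ L(Q)) ≤ (KL(Q‖P) + log (2√n/δ)) / n`. -/
theorem pac_bayes_kl_bound
    {Z W : Type*} [MeasurableSpace Z] [MeasurableSpace W]
    (D : Measure Z) [IsProbabilityMeasure D]
    (l : W → Z → ℝ) (hl : Measurable (Function.uncurry l))
    (hl01 : ∀ w z, l w z ∈ Set.Icc (0 : ℝ) 1)
    (n : ℕ) (hn : 1 ≤ n) (δ : ℝ) (hδ : δ ∈ Set.Ioo (0 : ℝ) 1)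
    (P : Measure W) [IsProbabilityMeasure P] :
    ENNReal.ofReal (1 - δ) ≤
      (Measure.pi fun _ : Fin n => D)
        {S | ∀ Q : Measure W, IsProbabilityMeasure Q →
          bernKL (∫ w, (n : ℝ)⁻¹ * ∑ i, l w (S i) ∂Q) (∫ w, ∫ z, l w z ∂D ∂Q)
            ≤ (KLdiv Q P + ENNReal.ofReal (Real.log (2 * Real.sqrt n / δ))) / (n : ℝ≥0∞)} := by
  have hn0 : n ≠ 0 := by omega
  have hn1 : (1 : ℝ) ≤ √n := one_le_sqrt.2 (by exact_mod_cast hn)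
  have hlw : ∀ w, Measurable (l w) := fun w => hl.comp measurable_prodMk_left
  have hli : ∀ w, Integrable (l w) D := fun w =>
    Integrable.of_bound (hlw w).aestronglyMeasurable 1
      (ae_of_all _ fun z => by rw [norm_of_nonneg (hl01 w z).1]; exact (hl01 w z).2)
  set p : W → ℝ := fun w => ∫ z, l w z ∂D
  set q : (Fin n → Z) → W → ℝ := fun S w => (n : ℝ)⁻¹ * ∑ i, l w (S i) with hq_def
  have hp : Measurable p := (hl.stronglyMeasurable.integral_prod_right).measurable
  have hq2 : Measurable fun x : W × (Fin n → Z) => q x.2 x.1 :=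
    (Finset.measurable_sum _ fun i _ => hl.comp
      (measurable_fst.prodMk ((measurable_pi_apply i).comp measurable_snd))).const_mul _
  have hp01 : ∀ w, p w ∈ Set.Icc (0 : ℝ) 1 := fun w => integral_mem_Icc (hli w) (hl01 w)
  have hq01 : ∀ S w, q S w ∈ Set.Icc (0 : ℝ) 1 := by
    intro S w
    refine ⟨mul_nonneg (by positivity) (Finset.sum_nonneg fun i _ => (hl01 w _).1), ?_⟩
    rw [hq_def, inv_mul_le_one₀ (by positivity)]
    simpa using Finset.sum_le_sum fun i (_ : i ∈ Finset.univ) => (hl01 w (S i)).2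
  set μ := Measure.pi fun _ : Fin n => D
  have h0 : ∀ᵐ S ∂μ, ∀ᵐ w ∂P, p w = 0 → q S w = 0 := by
    refine (Measure.ae_ae_comm (p := fun w S => p w = 0 → q S w = 0) ?_).1
      (ae_of_all _ fun w => ?_)
    · exact (measurableSet_eq_fun (hp.comp measurable_fst) measurable_const).imp
        (measurableSet_eq_fun hq2 measurable_const)
    · by_cases h : p w = 0
      · filter_upwards [ae_pi_of_ae (ι := Fin n)
          (ae_eq_zero_of_integral_eq_zero (hli w) (hl01 w) h)] with S hS _
        simp [hq_def, hS]
      · exact ae_of_all _ fun S e => absurd e h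
  have h1 : ∀ᵐ S ∂μ, ∀ᵐ w ∂P, p w = 1 → q S w = 1 := by
    refine (Measure.ae_ae_comm (p := fun w S => p w = 1 → q S w = 1) ?_).1
      (ae_of_all _ fun w => ?_)
    · exact (measurableSet_eq_fun (hp.comp measurable_fst) measurable_const).imp
        (measurableSet_eq_fun hq2 measurable_const)
    · by_cases h : p w = 1
      · filter_upwards [ae_pi_of_ae (ι := Fin n)
          (ae_eq_one_of_integral_eq_one (hli w) (hl01 w) h)] with S hS _
        simp [hq_def, hS, hn0]
      · exact ae_of_all _ fun S e => absurd e h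
  set F : W × (Fin n → Z) → ℝ≥0∞ := fun x =>
    ENNReal.ofReal (exp (n * interiorBernKL (q x.2 x.1) (p x.1))) with hF
  have hFm : Measurable F := ((measurable_interiorBernKL.comp
    (hq2.prodMk (hp.comp measurable_fst))).const_mul _).exp.ennreal_ofReal
  set M : (Fin n → Z) → ℝ≥0∞ := fun S => ∫⁻ w, F (w, S) ∂P with hM
  have hMm : Measurable M := hFm.lintegral_prod_left'
  have hMint : ∫⁻ S, M S ∂μ ≤ ENNReal.ofReal (2 * √n) := by
    rw [hM, lintegral_lintegral_swap (f := fun S w => F (w, S)) (hFm.comp measurable_swap).aemeasurable]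
    refine (lintegral_mono fun w =>
      lintegral_exp_mul_interiorBernKL_le D (hlw w) (hl01 w) hn).trans ?_
    simp
  set c := ENNReal.ofReal (2 * √n / δ)
  have hBpos : 0 < 2 * √n / δ := div_pos (by linarith) hδ.1
  have hMarkov : μ {S | c ≤ M S} ≤ ENNReal.ofReal δ := by
    refine (meas_ge_le_lintegral_div hMm.aemeasurable (ENNReal.ofReal_pos.2 hBpos).ne'
      ENNReal.ofReal_ne_top).trans ((ENNReal.div_le_div_right hMint _).trans_eq ?_)
    rw [← ENNReal.ofReal_div_of_pos hBpos, div_div_cancel₀ (by linarith)]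
  calc ENNReal.ofReal (1 - δ) = 1 - ENNReal.ofReal δ := by
        rw [ENNReal.ofReal_sub _ hδ.1.le, ENNReal.ofReal_one]
    _ ≤ 1 - μ {S | c ≤ M S} := tsub_le_tsub_left hMarkov _
    _ = μ {S | c ≤ M S}ᶜ := (prob_compl_eq_one_sub (measurableSet_le measurable_const hMm)).symm
    _ ≤ _ := by
      refine measure_mono_ae ?_
      filter_upwards [h0, h1] with S hS0 hS1 (hS : ¬ c ≤ M S) Q hQ
      exact bernKL_integral_le (hq2.comp measurable_prodMk_right) hp (hq01 S) hp01 hS0 hS1 hn0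
        hBpos.le (not_le.1 hS).le
end

section
/- (λ PAC-Bayes bound, Theorem 2.1, Eq. (2).) Fix a measurable loss l : W × Z → [0,1], a sample size n ≥ 1, a confidence level δ ∈ (0,1), and a data-free (prior) probability measure P on W. Then with probability at least 1−δ over the draw of S = (z₁,…,zₙ) i.i.d. from D, simultaneously for all probability measures Q on W and all λ ∈ (0,2): L(Q) ≤ L̂_S(Q)/(1 − λ/2) + (KL(Q∥P) + log(2√n/δ)) / (n·λ·(1 − λ/2)). -/
open MeasureTheory Real ENNReal Classical

namespace PACBayes

/-- The exponent whose supremum over `s ≥ 0` is `n (p - q)₊² / (2p)`. -/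
noncomputable def gain (n : ℕ) (s p q : ℝ) : ℝ := n * (s * (p - q) - s ^ 2 * p / 2)

lemma gain_mono {n : ℕ} {s t p q : ℝ}
    (h : s * (p - q) - s ^ 2 * p / 2 ≤ t * (p - q) - t ^ 2 * p / 2) :
    gain n s p q ≤ gain n t p q :=
  mul_le_mul_of_nonneg_left h n.cast_nonneg

lemma gain_le {n : ℕ} {s p q : ℝ} (hp : p ∈ Set.Icc (0 : ℝ) 1) (hq : 0 ≤ q) (hs : 0 ≤ s) :
    gain n s p q ≤ n / 2 := by
  have h : s * (p - q) - s ^ 2 * p / 2 ≤ 1 / 2 := by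
    nlinarith [mul_nonneg hp.1 (sq_nonneg (s - 1)), mul_nonneg hs hq, hp.2]
  have := mul_le_mul_of_nonneg_left h (n.cast_nonneg (α := ℝ))
  unfold gain
  linarith

lemma exists_nat_abs_sub_le {N : ℕ} (hN : 0 < N) {t : ℝ} (ht : t ∈ Set.Icc (0 : ℝ) 1) :
    ∃ j ≤ N, |(j : ℝ) / N - t| ≤ 1 / (2 * N) := by
  have hN' : (0 : ℝ) < N := by exact_mod_cast hN
  have h0 : 0 ≤ (N : ℝ) * t + 1 / 2 := by nlinarith [ht.1]
  have h1 := Nat.floor_le h0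
  have h2 := Nat.lt_floor_add_one ((N : ℝ) * t + 1 / 2)
  refine ⟨⌊(N : ℝ) * t + 1 / 2⌋₊, ?_, ?_⟩
  · have : (⌊(N : ℝ) * t + 1 / 2⌋₊ : ℝ) < N + 1 := by nlinarith [ht.2]
    exact Nat.lt_succ_iff.mp (by exact_mod_cast this)
  · have : (⌊(N : ℝ) * t + 1 / 2⌋₊ : ℝ) / N - t = (⌊(N : ℝ) * t + 1 / 2⌋₊ - N * t) / N := by
      field_simp
    rw [this, abs_div, abs_of_pos hN', div_le_div_iff₀ hN' (by positivity)]
    have : |(⌊(N : ℝ) * t + 1 / 2⌋₊ : ℝ) - N * t| ≤ 1 / 2 := by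
      rw [abs_le]; constructor <;> linarith
    nlinarith

/-- Up to an additive error, the exponent at any `s` is dominated on the grid `j / N`. -/
lemma exists_gain_le_grid (n : ℕ) {N : ℕ} (hN : 0 < N) {s p q : ℝ} (hp : p ∈ Set.Icc (0 : ℝ) 1)
    (hq : 0 ≤ q) (hs : 0 ≤ s) :
    ∃ j ≤ N, gain n s p q ≤ n / (8 * N ^ 2) + gain n (j / N) p q := by
  have hN' : (0 : ℝ) < N := by exact_mod_cast hN
  rcases le_or_gt p q with hpq | hpq
  · refine ⟨0, Nat.zero_le _, ?_⟩
    have h : gain n s p q ≤ gain n ((0 : ℕ) / N) p q := by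
      apply gain_mono
      have := mul_nonneg hs (sub_nonneg.2 hpq)
      have := mul_nonneg (sq_nonneg s) hp.1
      simp
      linarith
    have : (0 : ℝ) ≤ n / (8 * N ^ 2) := by positivity
    linarith
  · have hp0 : 0 < p := hq.trans_lt hpq
    obtain ⟨t, ht⟩ : ∃ t, t = (p - q) / p := ⟨_, rfl⟩
    have htp : p - q = p * t := by rw [ht]; field_simp
    have ht01 : t ∈ Set.Icc (0 : ℝ) 1 :=
      ⟨by rw [ht]; exact div_nonneg (by linarith) hp.1,
        by rw [ht, div_le_one hp0]; linarith⟩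
    obtain ⟨j, hj, hjt⟩ := exists_nat_abs_sub_le hN ht01
    refine ⟨j, hj, ?_⟩
    have hsq : ((j : ℝ) / N - t) ^ 2 ≤ 1 / (4 * N ^ 2) := by
      have := pow_le_pow_left₀ (abs_nonneg _) hjt 2
      rw [sq_abs] at this
      exact this.trans_eq (by field_simp; norm_num)
    have key : s * (p - q) - s ^ 2 * p / 2 ≤
        1 / (8 * N ^ 2) + (j / N * (p - q) - ((j : ℝ) / N) ^ 2 * p / 2) := by
      rw [htp]
      have h1 : p * ((j : ℝ) / N - t) ^ 2 ≤ 1 / (4 * N ^ 2) :=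
        (mul_le_of_le_one_left (sq_nonneg _) hp.2).trans hsq
      have h2 : (1 : ℝ) / (8 * N ^ 2) = 1 / (4 * N ^ 2) / 2 := by field_simp; norm_num
      rw [h2]
      nlinarith [mul_nonneg hp.1 (sq_nonneg (s - t))]
    have := mul_le_mul_of_nonneg_left key (n.cast_nonneg (α := ℝ))
    unfold gain
    calc _ ≤ _ := this
      _ = _ := by ring

lemma exp_quarter_le {n : ℕ} (h2 : 2 ≤ n) (h8 : n ≤ 8) : exp ((n : ℝ) / 4) ≤ n := by
  have he : exp 1 < 2.7182818286 := Real.exp_one_lt_d9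
  have h : exp ((n : ℝ) / 4) ^ 4 ≤ (n : ℝ) ^ 4 := by
    rw [← Real.exp_nat_mul, show ((4 : ℕ) : ℝ) * ((n : ℝ) / 4) = n * 1 by push_cast; ring,
      Real.exp_nat_mul]
    calc exp 1 ^ n ≤ (2.7182818286 : ℝ) ^ n := pow_le_pow_left₀ (exp_pos _).le he.le n
      _ ≤ _ := by interval_cases n <;> norm_num
  exact (pow_le_pow_iff_left₀ (exp_pos _).le n.cast_nonneg (by norm_num)).1 h

lemma exists_grid_size {n : ℕ} (hn : 2 ≤ n) :
    ∃ N : ℕ, 0 < N ∧ exp ((n : ℝ) / (8 * N ^ 2)) * (N + 1) ≤ 2 * √n := by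
  rcases le_or_gt n 8 with h8 | h8
  · refine ⟨1, one_pos, ?_⟩
    have : exp ((n : ℝ) / 8) ≤ √n := by
      apply Real.le_sqrt_of_sq_le
      rw [← Real.exp_nat_mul]
      convert exp_quarter_le hn h8 using 2
      push_cast; ring
    norm_num
    linarith
  · have hn9 : (9 : ℝ) ≤ n := by exact_mod_cast h8
    have hs3 : 3 ≤ √(n : ℝ) := Real.le_sqrt_of_sq_le (by linarith)
    have hsq : √(n : ℝ) ^ 2 = n := Real.sq_sqrt n.cast_nonneg
    have hle := Nat.le_ceil (√(n : ℝ) / 2)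
    have hlt := Nat.ceil_lt_add_one (a := √(n : ℝ) / 2) (by positivity)
    refine ⟨⌈√(n : ℝ) / 2⌉₊, Nat.ceil_pos.2 (by positivity), ?_⟩
    set N : ℝ := (⌈√(n : ℝ) / 2⌉₊ : ℝ)
    have hN : 0 < N := by linarith
    have h1 : (n : ℝ) / (8 * N ^ 2) ≤ 1 / 2 := by
      rw [div_le_iff₀ (by positivity)]
      nlinarith
    have he : exp (1 / 2 : ℝ) ≤ 1.65 := by
      have : exp (1 / 2 : ℝ) ^ 2 ≤ 1.65 ^ 2 := by
        rw [← Real.exp_nat_mul]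
        norm_num
        linarith [Real.exp_one_lt_d9]
      exact (pow_le_pow_iff_left₀ (exp_pos _).le (by norm_num) (by norm_num)).1 this
    calc _ ≤ 1.65 * (N + 1) :=
          mul_le_mul_of_nonneg_right ((Real.exp_le_exp.2 h1).trans he) (by linarith)
      _ ≤ _ := by linarith

lemma exists_finite_domination {n : ℕ} (hn : 1 ≤ n) :
    ∃ (m : ℕ) (s : Fin m → ℝ) (c : ℝ), 0 ≤ c ∧ (∀ j, 0 ≤ s j) ∧ c * m ≤ 2 * √n ∧
      ∀ p ∈ Set.Icc (0 : ℝ) 1, ∀ q, 0 ≤ q → ∀ t, 0 ≤ t →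
        exp (gain n t p q) ≤ c * ∑ j, exp (gain n (s j) p q) := by
  rcases hn.eq_or_lt with rfl | hn2
  · refine ⟨1, 0, exp (1 / 2), (exp_pos _).le, by simp, ?_, ?_⟩
    · have : exp (1 / 2 : ℝ) ^ 2 ≤ 2 ^ 2 := by
        rw [← Real.exp_nat_mul]
        norm_num
        linarith [Real.exp_one_lt_d9]
      simpa using (pow_le_pow_iff_left₀ (exp_pos _).le (by norm_num) (by norm_num)).1 this
    · intro p hp q hq t ht
      simpa [gain] using gain_le (n := 1) hp hq ht
  · obtain ⟨N, hN, hb⟩ := exists_grid_size hn2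
    refine ⟨N + 1, fun j => (j : ℕ) / N, exp ((n : ℝ) / (8 * N ^ 2)), (exp_pos _).le,
      fun j => by positivity, by simpa using hb, ?_⟩
    intro p hp q hq t ht
    obtain ⟨j, hj, h⟩ := exists_gain_le_grid n hN hp hq ht
    calc exp (gain n t p q) ≤ exp (n / (8 * N ^ 2) + gain n (j / N) p q) := Real.exp_le_exp.2 h
      _ = exp ((n : ℝ) / (8 * N ^ 2)) * exp (gain n (j / N) p q) := Real.exp_add _ _
      _ ≤ _ := by
        refine mul_le_mul_of_nonneg_left ?_ (exp_pos _).le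
        have hj' : j ∈ Finset.range (N + 1) := Finset.mem_range.2 (by omega)
        rw [Fin.sum_univ_eq_sum_range (fun i => exp (gain n ((i : ℝ) / N) p q))]
        exact Finset.single_le_sum (f := fun i : ℕ => exp (gain n ((i : ℝ) / N) p q))
          (fun i _ => (exp_pos _).le) hj'

lemma exp_neg_le_quadratic {x : ℝ} (hx : 0 ≤ x) : exp (-x) ≤ 1 - x + x ^ 2 / 2 := by
  have h := Real.quadratic_le_exp_of_nonneg hx
  have h1 : 0 < 1 - x + x ^ 2 / 2 := by nlinarith [sq_nonneg (x - 1)]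
  rw [Real.exp_neg, inv_le_comm₀ (exp_pos _) h1]
  refine le_trans ?_ h
  rw [inv_le_iff_one_le_mul₀ h1]
  nlinarith [sq_nonneg (x ^ 2)]

section

variable {Z : Type*} [MeasurableSpace Z] (D : Measure Z) [IsProbabilityMeasure D]

lemma integrable_of_mem_Icc {f : Z → ℝ} (hf : Measurable f)
    (h01 : ∀ z, f z ∈ Set.Icc (0 : ℝ) 1) : Integrable f D :=
  Integrable.of_bound hf.aestronglyMeasurable 1
    (Filter.Eventually.of_forall fun z => by
      rw [Real.norm_of_nonneg (h01 z).1]; exact (h01 z).2)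

lemma integral_mem_Icc {f : Z → ℝ} (hf : Measurable f)
    (h01 : ∀ z, f z ∈ Set.Icc (0 : ℝ) 1) : ∫ z, f z ∂D ∈ Set.Icc (0 : ℝ) 1 := by
  refine ⟨integral_nonneg fun z => (h01 z).1, ?_⟩
  simpa using integral_mono (integrable_of_mem_Icc D hf h01) (integrable_const 1)
    fun z => (h01 z).2

lemma integral_exp_lower_tail_le_one {f : Z → ℝ} (hf : Measurable f)
    (h01 : ∀ z, f z ∈ Set.Icc (0 : ℝ) 1) {s : ℝ} (hs : 0 ≤ s) :
    ∫ z, exp (s * (∫ x, f x ∂D - f z) - s ^ 2 * (∫ x, f x ∂D) / 2) ∂D ≤ 1 := by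
  set p := ∫ x, f x ∂D with hp
  have hfi := integrable_of_mem_Icc D hf h01
  have hbound : ∀ z, exp (-(s * f z)) ≤ 1 + (-s + s ^ 2 / 2) * f z := fun z => by
    have := exp_neg_le_quadratic (mul_nonneg hs (h01 z).1)
    nlinarith [mul_nonneg (sq_nonneg s) (mul_nonneg (h01 z).1 (sub_nonneg.2 (h01 z).2))]
  have hmgf : ∫ z, exp (-(s * f z)) ∂D ≤ exp ((-s + s ^ 2 / 2) * p) := by
    calc _ ≤ ∫ z, (1 + (-s + s ^ 2 / 2) * f z) ∂D :=
          integral_mono_of_nonneg (Filter.Eventually.of_forall fun z => (exp_pos _).le)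
            ((integrable_const _).add (hfi.const_mul _)) (Filter.Eventually.of_forall hbound)
      _ = (-s + s ^ 2 / 2) * p + 1 := by
          rw [integral_add (integrable_const _) (hfi.const_mul _), integral_const_mul]
          simp [hp, add_comm]
      _ ≤ _ := Real.add_one_le_exp _
  calc ∫ z, exp (s * (p - f z) - s ^ 2 * p / 2) ∂D
      = exp (-((-s + s ^ 2 / 2) * p)) * ∫ z, exp (-(s * f z)) ∂D := by
        rw [← integral_const_mul (exp (-((-s + s ^ 2 / 2) * p)))]
        congr! 2 with z
        rw [← Real.exp_add]
        ring_nf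
    _ ≤ exp (-((-s + s ^ 2 / 2) * p)) * exp ((-s + s ^ 2 / 2) * p) := by gcongr
    _ = 1 := by rw [← Real.exp_add]; simp

lemma lintegral_exp_gain_le_one {n : ℕ} (hn : 1 ≤ n) {f : Z → ℝ} (hf : Measurable f)
    (h01 : ∀ z, f z ∈ Set.Icc (0 : ℝ) 1) {s : ℝ} (hs : 0 ≤ s) :
    ∫⁻ S : Fin n → Z, ENNReal.ofReal
        (exp (gain n s (∫ z, f z ∂D) ((n : ℝ)⁻¹ * ∑ i, f (S i)))) ∂Measure.pi (fun _ => D)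
      ≤ 1 := by
  have hp := integral_mem_Icc D hf h01
  have hmean_nonneg : ∀ S : Fin n → Z, 0 ≤ (n : ℝ)⁻¹ * ∑ i, f (S i) := fun S =>
    mul_nonneg (by positivity) (Finset.sum_nonneg fun i _ => (h01 _).1)
  have hint : Integrable (fun S : Fin n → Z =>
      exp (gain n s (∫ z, f z ∂D) ((n : ℝ)⁻¹ * ∑ i, f (S i)))) (Measure.pi fun _ => D) := by
    refine Integrable.of_bound (Measurable.aestronglyMeasurable ?_) (exp (n / 2))
      (Filter.Eventually.of_forall fun S => ?_)
    · unfold gain; fun_prop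
    · rw [Real.norm_of_nonneg (exp_pos _).le]
      exact Real.exp_le_exp.2 (gain_le hp (hmean_nonneg S) hs)
  rw [← ofReal_integral_eq_lintegral_ofReal hint
    (Filter.Eventually.of_forall fun S => (exp_pos _).le), ENNReal.ofReal_le_one]
  have hprod : ∀ S : Fin n → Z,
      exp (gain n s (∫ z, f z ∂D) ((n : ℝ)⁻¹ * ∑ i, f (S i))) =
        ∏ i, exp (s * (∫ x, f x ∂D - f (S i)) - s ^ 2 * (∫ x, f x ∂D) / 2) := fun S => by
    have hn0 : (n : ℝ) ≠ 0 := by positivity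
    rw [← Real.exp_sum, Finset.sum_sub_distrib, ← Finset.mul_sum, Finset.sum_sub_distrib]
    simp only [Finset.sum_const, Finset.card_univ, Fintype.card_fin, nsmul_eq_mul, gain]
    congr 1
    field_simp
  simp_rw [hprod]
  rw [integral_fintype_prod_eq_pow
    (fun z => exp (s * (∫ x, f x ∂D - f z) - s ^ 2 * (∫ x, f x ∂D) / 2))]
  exact pow_le_one₀ (integral_nonneg fun z => (exp_pos _).le)
    (integral_exp_lower_tail_le_one D hf h01 hs)

end

/-- The change of measure inequality of Donsker and Varadhan. -/
lemma integral_le_integral_llr_add_log {W : Type*} [MeasurableSpace W] {Q P : Measure W}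
    [IsProbabilityMeasure Q] [IsProbabilityMeasure P] (hQP : Q ≪ P)
    (hllr : Integrable (llr Q P) Q) {g : W → ℝ} (hgQ : Integrable g Q)
    (hgP : Integrable (fun w => exp (g w)) P) :
    ∫ w, g w ∂Q ≤ ∫ w, llr Q P w ∂Q + log (∫ w, exp (g w) ∂P) := by
  have : IsProbabilityMeasure (P.tilted g) := isProbabilityMeasure_tilted hgP
  have h := integral_llr_tilted_right hQP hgQ hgP hllr
  have h0 : 0 ≤ ∫ w, llr Q (P.tilted g) w ∂Q := by
    rw [← InformationTheory.toReal_klDiv_of_measure_eq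
      (hQP.trans (absolutelyContinuous_tilted hgP)) (by simp)]
    exact ENNReal.toReal_nonneg
  linarith

end PACBayes

open PACBayes

/-- The λ PAC-Bayes bound: with probability at least `1 - δ` over the draw of an i.i.d.
sample `S ∼ Dⁿ`, simultaneously for all posteriors `Q` and all `λ ∈ (0, 2)`,
`L(Q) ≤ L̂_S(Q)/(1 - λ/2) + (KL(Q‖P) + log (2√n/δ)) / (n·λ·(1 - λ/2))`. -/
theorem pac_bayes_lambda_bound
    {Z W : Type*} [MeasurableSpace Z] [MeasurableSpace W]
    (D : Measure Z) [IsProbabilityMeasure D]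
    (l : W → Z → ℝ) (hl : Measurable (Function.uncurry l))
    (hl01 : ∀ w z, l w z ∈ Set.Icc (0 : ℝ) 1)
    (n : ℕ) (hn : 1 ≤ n) (δ : ℝ) (hδ : δ ∈ Set.Ioo (0 : ℝ) 1)
    (P : Measure W) [IsProbabilityMeasure P] :
    ENNReal.ofReal (1 - δ) ≤
      (Measure.pi fun _ : Fin n => D)
        {S | ∀ Q : Measure W, IsProbabilityMeasure Q → ∀ lam ∈ Set.Ioo (0 : ℝ) 2,
          ENNReal.ofReal (∫ w, ∫ z, l w z ∂D ∂Q)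
            ≤ ENNReal.ofReal ((∫ w, (n : ℝ)⁻¹ * ∑ i, l w (S i) ∂Q) / (1 - lam / 2))
              + (KLdiv Q P + ENNReal.ofReal (Real.log (2 * Real.sqrt n / δ)))
                  / ENNReal.ofReal (n * lam * (1 - lam / 2))} := by
  have hn0 : (0 : ℝ) < n := by exact_mod_cast hn
  obtain ⟨hδ0, hδ1⟩ := hδ
  obtain ⟨m, s, c, hc, hs, hcm, hdom⟩ := exists_finite_domination hn
  set μ : Measure (Fin n → Z) := Measure.pi fun _ : Fin n => D
  set p : W → ℝ := fun w => ∫ z, l w z ∂D with hp_def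
  set q : (Fin n → Z) → W → ℝ := fun S w => (n : ℝ)⁻¹ * ∑ i, l w (S i) with hq_def
  have hlw : ∀ w, Measurable (l w) := fun w => hl.comp measurable_prodMk_left
  have hp : Measurable p := (hl.stronglyMeasurable.integral_prod_right (ν := D)).measurable
  have hp01 : ∀ w, p w ∈ Set.Icc (0 : ℝ) 1 := fun w => integral_mem_Icc D (hlw w) (hl01 w)
  have hq : Measurable (Function.uncurry q) := by
    refine Measurable.const_mul (Finset.measurable_fun_sum _ fun i _ => ?_) _
    exact hl.comp (measurable_snd.prodMk ((measurable_pi_apply i).comp measurable_fst))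
  have hqS : ∀ S, Measurable (q S) := fun S => hq.comp measurable_prodMk_left
  have hq01 : ∀ S w, q S w ∈ Set.Icc (0 : ℝ) 1 := fun S w => by
    refine ⟨mul_nonneg (by positivity) (Finset.sum_nonneg fun i _ => (hl01 _ _).1), ?_⟩
    rw [inv_mul_le_iff₀ hn0]
    simpa using Finset.sum_le_sum fun (i : Fin n) (_ : i ∈ Finset.univ) => (hl01 w (S i)).2
  have hgain : ∀ t, Measurable fun x : (Fin n → Z) × W =>
      ENNReal.ofReal (exp (gain n t (p x.2) (q x.1 x.2))) := fun t => by
    have : Measurable fun x : (Fin n → Z) × W => q x.1 x.2 := hq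
    unfold gain
    fun_prop
  set V : (Fin n → Z) → W → ℝ≥0∞ := fun S w =>
    ENNReal.ofReal c * ∑ j, ENNReal.ofReal (exp (gain n (s j) (p w) (q S w)))
  have hV : Measurable (Function.uncurry V) :=
    (Finset.measurable_fun_sum _ fun j _ => hgain (s j)).const_mul _
  have hM : Measurable fun S => ∫⁻ w, V S w ∂P := hV.lintegral_prod_right
  have hEV : ∫⁻ S, ∫⁻ w, V S w ∂P ∂μ ≤ ENNReal.ofReal (2 * √n) := by
    rw [lintegral_lintegral_swap hV.aemeasurable]
    have : ∀ w, ∫⁻ S, V S w ∂μ ≤ ENNReal.ofReal (2 * √n) := fun w => by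
      have hmeas : ∀ j, Measurable fun S : Fin n → Z =>
          ENNReal.ofReal (exp (gain n (s j) (p w) (q S w))) := fun j => by
        have : Measurable fun S => q S w := hq.of_uncurry_right
        unfold gain
        fun_prop
      rw [lintegral_const_mul _ (Finset.measurable_fun_sum _ fun j _ => hmeas j),
        lintegral_finsetSum _ fun j _ => hmeas j]
      calc _ ≤ ENNReal.ofReal c * ∑ _j : Fin m, 1 := by
            gcongr with j _
            exact lintegral_exp_gain_le_one D hn (hlw w) (hl01 w) (hs j)
        _ = ENNReal.ofReal (c * m) := by simp [ENNReal.ofReal_mul hc]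
        _ ≤ _ := ENNReal.ofReal_le_ofReal hcm
    calc _ ≤ ∫⁻ _w, ENNReal.ofReal (2 * √n) ∂P := lintegral_mono this
      _ = _ := by simp
  set B : ℝ := 2 * √n / δ
  have hB : 0 < B := by positivity
  have hbad : μ {S | ENNReal.ofReal B ≤ ∫⁻ w, V S w ∂P} ≤ ENNReal.ofReal δ := by
    refine (meas_ge_le_lintegral_div hM.aemeasurable (by simpa using hB)
      ENNReal.ofReal_ne_top).trans ((ENNReal.div_le_div_right hEV _).trans ?_)
    rw [← ENNReal.ofReal_div_of_pos hB]
    refine ENNReal.ofReal_le_ofReal (le_of_eq ?_)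
    simp only [B]
    field_simp
  have hgood : ENNReal.ofReal (1 - δ) ≤ μ {S | ENNReal.ofReal B ≤ ∫⁻ w, V S w ∂P}ᶜ := by
    rw [prob_compl_eq_one_sub (measurableSet_le measurable_const hM),
      ENNReal.ofReal_sub _ hδ0.le, ENNReal.ofReal_one]
    exact tsub_le_tsub_left hbad 1
  refine hgood.trans (measure_mono fun S hS Q hQ lam hlam => ?_)
  obtain ⟨hl0, hl2⟩ := hlam
  have hden : 0 < 1 - lam / 2 := by linarith
  have hden' : 0 < n * lam * (1 - lam / 2) := by positivity
  unfold KLdiv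
  split_ifs with hKL
  swap
  · simp [ENNReal.top_div]
  obtain ⟨hQP, hllr⟩ := hKL
  replace hS : ∫⁻ w, V S w ∂P ≤ ENNReal.ofReal B := (not_le.1 (Set.mem_compl_iff _ _ |>.1 hS)).le
  have hpQ := integrable_of_mem_Icc Q hp hp01
  have hqQ := integrable_of_mem_Icc Q (hqS S) (hq01 S)
  have hg_eq : (fun w => gain n lam (p w) (q S w)) =
      fun w => (n * lam * (1 - lam / 2)) * p w - (n * lam) * q S w := by
    funext w; unfold gain; ring
  have hgQ : Integrable (fun w => gain n lam (p w) (q S w)) Q := by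
    rw [hg_eq]; exact (hpQ.const_mul _).sub (hqQ.const_mul _)
  have hgP : Integrable (fun w => exp (gain n lam (p w) (q S w))) P := by
    refine Integrable.of_bound (Measurable.aestronglyMeasurable ?_) (exp (n / 2))
      (Filter.Eventually.of_forall fun w => ?_)
    · have := hqS S
      unfold gain; fun_prop
    · rw [Real.norm_of_nonneg (exp_pos _).le]
      exact Real.exp_le_exp.2 (gain_le (hp01 w) (hq01 S w).1 hl0.le)
  have hexp : ∫ w, exp (gain n lam (p w) (q S w)) ∂P ≤ B := by
    rw [← ENNReal.ofReal_le_ofReal_iff hB.le, ofReal_integral_eq_lintegral_ofReal hgP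
      (Filter.Eventually.of_forall fun w => (exp_pos _).le)]
    refine (lintegral_mono fun w => ?_).trans hS
    calc _ ≤ ENNReal.ofReal (c * ∑ j, exp (gain n (s j) (p w) (q S w))) :=
          ENNReal.ofReal_le_ofReal (hdom _ (hp01 w) _ (hq01 S w).1 _ hl0.le)
      _ = V S w := by
          rw [ENNReal.ofReal_mul hc, ENNReal.ofReal_sum_of_nonneg fun j _ => (exp_pos _).le]
  have hDV := integral_le_integral_llr_add_log hQP hllr hgQ hgP
  have hlog := Real.log_le_log (integral_exp_pos hgP) hexp
  have hlin : ∫ w, gain n lam (p w) (q S w) ∂Q =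
      n * lam * (1 - lam / 2) * ∫ w, p w ∂Q - n * lam * ∫ w, q S w ∂Q := by
    rw [hg_eq, integral_sub (hpQ.const_mul _) (hqQ.const_mul _), integral_const_mul,
      integral_const_mul]
  have hmain : ∫ w, p w ∂Q ≤ (∫ w, q S w ∂Q) / (1 - lam / 2) +
      (∫ w, llr Q P w ∂Q + log B) / (n * lam * (1 - lam / 2)) := by
    have : (∫ w, q S w ∂Q) / (1 - lam / 2) =
        (n * lam * ∫ w, q S w ∂Q) / (n * lam * (1 - lam / 2)) := by
      rw [mul_div_mul_left _ _ (by positivity)]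
    rw [this, ← add_div, le_div_iff₀ hden']
    linarith
  calc ENNReal.ofReal (∫ w, p w ∂Q)
      ≤ ENNReal.ofReal ((∫ w, q S w ∂Q) / (1 - lam / 2)) +
        ENNReal.ofReal ((∫ w, llr Q P w ∂Q + log B) / (n * lam * (1 - lam / 2))) :=
        (ENNReal.ofReal_le_ofReal hmain).trans ENNReal.ofReal_add_le
    _ ≤ _ := by
        rw [ENNReal.ofReal_div_of_pos hden']
        gcongr
        exact ENNReal.ofReal_add_le
end

section
/- (Deterministic relaxation turning the kl bound into the λ bound.) Let p̂, p ∈ [0,1] and b ≥ 0. If kl(p̂ ∥ p) ≤ b, then for every λ ∈ (0,2): p ≤ p̂/(1 − λ/2) + b/(λ·(1 − λ/2)). -/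
open MeasureTheory Real ENNReal Classical

/-- A tilted form of `x - y ≤ x * log (x / y)`. -/
theorem sub_mul_exp_neg_le_mul_log_div_add {x y : ℝ} (c : ℝ) (hx : 0 ≤ x) (hy : 0 ≤ y)
    (hxy : y = 0 → x = 0) : x - y * Real.exp (-c) ≤ x * Real.log (x / y) + c * x := by
  rcases hx.eq_or_lt with rfl | hx
  · simpa using mul_nonneg hy (Real.exp_pos (-c)).le
  have hy : 0 < y := lt_of_le_of_ne hy fun h0 => hx.ne' (hxy h0.symm)
  have hlog := Real.log_le_sub_one_of_pos (div_pos (mul_pos hy (Real.exp_pos (-c))) hx)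
  rw [Real.log_div (by positivity) hx.ne', Real.log_mul hy.ne' (by positivity),
    Real.log_exp] at hlog
  rw [Real.log_div hx.ne' hy.ne']
  have hmul := mul_le_mul_of_nonneg_left hlog hx.le
  have hcancel : x * (y * Real.exp (-c) / x - 1) = y * Real.exp (-c) - x := by
    field_simp
  linarith

/-- The second-order Taylor polynomial of `exp (-x)` is an upper bound for `0 ≤ x`. -/
theorem exp_neg_le_one_sub_add_sq_div_two {x : ℝ} (hx : 0 ≤ x) :
    Real.exp (-x) ≤ 1 - x + x ^ 2 / 2 := by
  have hexp := Real.quadratic_le_exp_of_nonneg hx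
  have hpos : 0 ≤ 1 - x + x ^ 2 / 2 := by nlinarith [sq_nonneg (x - 1)]
  rw [Real.exp_neg, inv_le_iff_one_le_mul₀ (Real.exp_pos x)]
  nlinarith [mul_le_mul_of_nonneg_left hexp hpos, sq_nonneg (x ^ 2)]

/-- Deterministic relaxation turning the kl bound into the λ bound: if
`kl(p̂ ‖ p) ≤ b` then for every `λ ∈ (0,2)`, `p ≤ p̂/(1 - λ/2) + b/(λ(1 - λ/2))`. -/
theorem kl_bound_to_lambda_bound (phat p b : ℝ)
    (hphat : phat ∈ Set.Icc (0 : ℝ) 1) (hp : p ∈ Set.Icc (0 : ℝ) 1) (hb : 0 ≤ b)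
    (h : bernKL phat p ≤ ENNReal.ofReal b) :
    ∀ lam ∈ Set.Ioo (0 : ℝ) 2, p ≤ phat / (1 - lam / 2) + b / (lam * (1 - lam / 2)) := by
  rintro lam ⟨hlam, hlam2⟩
  obtain ⟨hq0, hq1⟩ := hphat
  obtain ⟨hp0, hp1⟩ := hp
  unfold bernKL at h
  split_ifs at h with hc
  · exact absurd (top_le_iff.mp h) ENNReal.ofReal_ne_top
  rw [ENNReal.ofReal_le_ofReal_iff hb] at h
  push Not at hc
  have hsucc := sub_mul_exp_neg_le_mul_log_div_add lam hq0 hp0 hc.1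
  have hfail := sub_mul_exp_neg_le_mul_log_div_add 0 (sub_nonneg.mpr hq1) (sub_nonneg.mpr hp1)
    fun h1 => by linarith [hc.2 (by linarith)]
  simp only [neg_zero, Real.exp_zero, mul_one, zero_mul, add_zero] at hfail
  have hexp := mul_le_mul_of_nonneg_left (exp_neg_le_one_sub_add_sq_div_two hlam.le) hp0
  have hden : 0 < 1 - lam / 2 := by linarith
  have hsum : phat / (1 - lam / 2) + b / (lam * (1 - lam / 2)) =
      (lam * phat + b) / (lam * (1 - lam / 2)) := by
    field_simp
  rw [hsum, le_div_iff₀ (mul_pos hlam hden)]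
  linarith
end

section
/- (Theorem 2.3: sample-convergence kl-inverse bound.) Let Q be a probability measure on a measurable space W, h : W → [0,1] a measurable function, m ≥ 1, and δ′ ∈ (0,1). If W₁,…,W_m are i.i.d. with law Q, then with probability at least 1−δ′: E_{w∼Q}[h(w)] ≤ kl⁻¹( (1/m)∑_{j=1}^m h(W_j), (1/m)·log(2/δ′) ). -/
open MeasureTheory Real ENNReal Classical

/-- Inverse Bernoulli KL: `kl⁻¹(x, b) = sup { y ∈ [x,1] : kl(x‖y) ≤ b }`. -/
noncomputable def klInv (x : ℝ) (b : ℝ≥0∞) : ℝ :=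
  sSup {y : ℝ | y ∈ Set.Icc x 1 ∧ bernKL x y ≤ b}

/-- Chernoff bound in KL form for the lower tail of a sum of i.i.d. `[0,1]`-valued variables. -/
theorem measure_sum_le_le_exp_neg_kl
    {W : Type*} [MeasurableSpace W] (Q : Measure W) [IsProbabilityMeasure Q]
    (h : W → ℝ) (hh : Measurable h) (hh01 : ∀ w, h w ∈ Set.Icc (0 : ℝ) 1)
    (m : ℕ) (μ a : ℝ) (hμ : ∫ w, h w ∂Q = μ) (hμ0 : 0 < μ) (hμ1 : μ < 1)
    (ha0 : 0 ≤ a) (haμ : a ≤ μ) :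
    (Measure.pi fun _ : Fin m => Q).real {ws | ∑ j, h (ws j) ≤ m * a} ≤
      Real.exp (-(m * (a * Real.log (a / μ) + (1 - a) * Real.log ((1 - a) / (1 - μ))))) := by
  have hh_int : Integrable h Q :=
    Integrable.of_bound hh.aestronglyMeasurable 1
      (Filter.Eventually.of_forall fun w => by
        rw [Real.norm_of_nonneg (hh01 w).1]; exact (hh01 w).2)
  set p := a / μ with hp
  set r := (1 - a) / (1 - μ) with hr
  have hp0 : 0 ≤ p := by positivity
  have hp1 : p ≤ 1 := (div_le_one hμ0).2 haμ
  have hr1 : 1 ≤ r := (one_le_div (by linarith)).2 (by linarith)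
  have hr0 : 0 < r := by linarith
  let f : W → ℝ := fun w => h w * p + (1 - h w) * r
  have hf0 : ∀ w, 0 ≤ f w := fun w =>
    add_nonneg (mul_nonneg (hh01 w).1 hp0) (mul_nonneg (by linarith [(hh01 w).2]) hr0.le)
  have hi2 : Integrable (fun w => (1 - h w) * r) Q :=
    ((integrable_const (1 : ℝ)).sub hh_int).mul_const r
  have hfint : Integrable f Q := (hh_int.mul_const p).add hi2
  have hEf : ∫ w, f w ∂Q = 1 := by
    simp only [f]
    rw [integral_add (hh_int.mul_const p) hi2, integral_mul_const, integral_mul_const,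
      integral_sub (integrable_const _) hh_int, hμ]
    simp only [integral_const, probReal_univ, smul_eq_mul, mul_one, hp, hr]
    have : 1 - μ ≠ 0 := by linarith
    field_simp
    ring
  have hprod : ∫ ws, ∏ j, f (ws j) ∂(Measure.pi fun _ : Fin m => Q) = 1 := by
    rw [integral_fintype_prod_eq_prod (fun _ : Fin m => f)]
    simp [hEf]
  have hprodint : Integrable (fun ws : Fin m → W => ∏ j, f (ws j))
      (Measure.pi fun _ : Fin m => Q) :=
    Integrable.fintype_prod (f := fun _ : Fin m => f) fun _ => hfint
  set E := Real.exp (m * (a * Real.log p + (1 - a) * Real.log r)) with hE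
  have hpow : p ^ (m * a) * r ^ (m - m * a) = E := by
    have h1 : p ^ (m * a) = Real.exp (m * (a * Real.log p)) := by
      rcases ha0.eq_or_lt with h0 | h0
      · simp [← h0]
      · rw [Real.rpow_def_of_pos (by positivity)]; ring_nf
    rw [h1, Real.rpow_def_of_pos hr0, ← Real.exp_add, hE]
    ring_nf
  have hsub : {ws : Fin m → W | ∑ j, h (ws j) ≤ m * a} ⊆ {ws | E ≤ ∏ j, f (ws j)} := by
    intro ws hws
    simp only [Set.mem_ofPred_eq] at hws ⊢
    have hS0 : 0 ≤ ∑ j, h (ws j) := Finset.sum_nonneg fun j _ => (hh01 _).1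
    calc E = p ^ (m * a) * r ^ (m - m * a) := hpow.symm
      _ ≤ p ^ (∑ j, h (ws j)) * r ^ (∑ j, (1 - h (ws j))) := by
          gcongr ?_ * ?_
          · exact Real.rpow_le_rpow_of_exponent_ge' hp0 hp1 hS0 hws
          · refine Real.rpow_le_rpow_of_exponent_le hr1 ?_
            simp only [Finset.sum_sub_distrib, Finset.sum_const, Finset.card_univ,
              Fintype.card_fin, nsmul_eq_mul, mul_one]
            linarith
      _ = ∏ j, (p ^ h (ws j) * r ^ (1 - h (ws j))) := by
          rw [Real.rpow_sum_of_nonneg hp0 fun j _ => (hh01 _).1,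
            Real.rpow_sum_of_nonneg hr0.le fun j _ => by linarith [(hh01 (ws j)).2],
            Finset.prod_mul_distrib]
      _ ≤ ∏ j, f (ws j) := by
          refine Finset.prod_le_prod (fun j _ => by positivity) fun j _ => ?_
          exact Real.geom_mean_le_arith_mean2_weighted (hh01 _).1
            (by linarith [(hh01 (ws j)).2]) hp0 hr0.le (by ring)
  have hmarkov := mul_meas_ge_le_integral_of_nonneg
    (Filter.Eventually.of_forall fun ws : Fin m → W =>
      Finset.prod_nonneg fun j _ => hf0 (ws j)) hprodint E
  rw [hprod] at hmarkov
  rw [Real.exp_neg, ← hE, ← one_div, le_div_iff₀ (Real.exp_pos _), mul_comm]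
  exact (mul_le_mul_of_nonneg_left (measureReal_mono hsub) (Real.exp_pos _).le).trans hmarkov

theorem bernKL_self (x : ℝ) : bernKL x x = 0 := by
  simp [bernKL]

theorem le_klInv_of_bernKL_le {x y : ℝ} {b : ℝ≥0∞} (hxy : x ≤ y) (hy : y ≤ 1)
    (hb : bernKL x y ≤ b) : y ≤ klInv x b :=
  le_csSup ⟨1, fun _ hz => hz.1.2⟩ ⟨⟨hxy, hy⟩, hb⟩

theorem le_klInv_self {x : ℝ} (b : ℝ≥0∞) (hx : x ≤ 1) : x ≤ klInv x b :=
  le_klInv_of_bernKL_le le_rfl hx (by simp [bernKL_self])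

theorem continuous_bernoulli_kl {p : ℝ} (h0 : p ≠ 0) (h1 : p ≠ 1) :
    Continuous fun q : ℝ => q * Real.log (q / p) + (1 - q) * Real.log ((1 - q) / (1 - p)) := by
  have key {c : ℝ} (hc : c ≠ 0) : Continuous fun q : ℝ => q * Real.log (q / c) := by
    have : (fun q : ℝ => q * Real.log (q / c)) =
        fun q => c * (q / c * Real.log (q / c)) := by
      ext q; field_simp
    rw [this]
    exact continuous_const.mul (Real.continuous_mul_log.comp (continuous_id.div_const c))
  exact (key h0).add ((key (sub_ne_zero.2 h1.symm)).comp (continuous_const.sub continuous_id))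

/-- Theorem 2.3: for an i.i.d. sample `W₁, …, W_m ∼ Q` and `h : W → [0,1]`, with
probability at least `1 - δ'`,
`E_{w∼Q}[h(w)] ≤ kl⁻¹((1/m)∑ⱼ h(Wⱼ), (1/m) log(2/δ'))`. -/
theorem kl_inverse_sample_bound
    {W : Type*} [MeasurableSpace W] (Q : Measure W) [IsProbabilityMeasure Q]
    (h : W → ℝ) (hh : Measurable h) (hh01 : ∀ w, h w ∈ Set.Icc (0 : ℝ) 1)
    (m : ℕ) (hm : 1 ≤ m) (δ' : ℝ) (hδ' : δ' ∈ Set.Ioo (0 : ℝ) 1) :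
    ENNReal.ofReal (1 - δ') ≤
      (Measure.pi fun _ : Fin m => Q)
        {ws | ∫ w, h w ∂Q ≤
          klInv ((m : ℝ)⁻¹ * ∑ j, h (ws j))
            (ENNReal.ofReal ((m : ℝ)⁻¹ * Real.log (2 / δ')))} := by
  obtain ⟨hδ0, hδ1⟩ := hδ'
  have hm0 : (0 : ℝ) < m := by exact_mod_cast hm
  set b := (m : ℝ)⁻¹ * Real.log (2 / δ') with hb
  have hb0 : 0 < b :=
    mul_pos (by positivity) (Real.log_pos ((one_lt_div hδ0).2 (by linarith)))
  set P := Measure.pi fun _ : Fin m => Q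
  have hh_int : Integrable h Q :=
    Integrable.of_bound hh.aestronglyMeasurable 1
      (Filter.Eventually.of_forall fun w => by
        rw [Real.norm_of_nonneg (hh01 w).1]; exact (hh01 w).2)
  have hμ1 : ∫ w, h w ∂Q ≤ 1 := by
    simpa using integral_mono hh_int (integrable_const (1 : ℝ)) fun w => (hh01 w).2
  have hx0 (ws : Fin m → W) : 0 ≤ (m : ℝ)⁻¹ * ∑ j, h (ws j) :=
    mul_nonneg (by positivity) (Finset.sum_nonneg fun j _ => (hh01 _).1)
  have hx1 (ws : Fin m → W) : (m : ℝ)⁻¹ * ∑ j, h (ws j) ≤ 1 := by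
    rw [inv_mul_le_one₀ hm0]
    simpa using Finset.sum_le_sum fun j (_ : j ∈ Finset.univ) => (hh01 (ws j)).2
  have hgood (ws : Fin m → W) (hle : ∫ w, h w ∂Q ≤ (m : ℝ)⁻¹ * ∑ j, h (ws j)) :
      ∫ w, h w ∂Q ≤ klInv ((m : ℝ)⁻¹ * ∑ j, h (ws j)) (ENNReal.ofReal b) :=
    hle.trans (le_klInv_self _ (hx1 ws))
  have hofReal : ENNReal.ofReal (1 - δ') ≤ 1 := ENNReal.ofReal_le_one.2 (by linarith)
  rcases hμ1.eq_or_lt with hμ | hμ1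
  · have hae : ∀ᵐ w ∂Q, h w = 1 := by
      have h0 : ∫ w, (1 - h w) ∂Q = 0 := by
        rw [integral_sub (integrable_const _) hh_int, hμ]; simp
      rw [integral_eq_zero_iff_of_nonneg (fun w => sub_nonneg.2 (hh01 w).2)
        ((integrable_const _).sub hh_int)] at h0
      filter_upwards [h0] with w hw
      simp only [Pi.zero_apply] at hw
      linarith
    have hall : ∀ᵐ ws ∂P, ∀ j, h (ws j) = 1 :=
      ae_all_iff.2 fun j =>
      (Measure.tendsto_eval_ae_ae (μ := fun _ : Fin m => Q) (i := j)).eventually hae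
    refine hofReal.trans ?_
    rw [← measure_univ (μ := P)]
    refine measure_mono_ae ?_
    filter_upwards [hall] with ws hws _
    refine hgood ws ?_
    simp [hws, hμ, hm0.ne']
  · set μ := ∫ w, h w ∂Q with hμ
    let k : ℝ → ℝ := fun q =>
      q * Real.log (q / μ) + (1 - q) * Real.log ((1 - q) / (1 - μ))
    have hk (ws : Fin m → W) (hμ0 : 0 < μ) (hkb : k ((m : ℝ)⁻¹ * ∑ j, h (ws j)) ≤ b)
        (hle : (m : ℝ)⁻¹ * ∑ j, h (ws j) ≤ μ) :
        μ ≤ klInv ((m : ℝ)⁻¹ * ∑ j, h (ws j)) (ENNReal.ofReal b) := by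
      refine le_klInv_of_bernKL_le hle hμ1.le ?_
      rw [bernKL, if_neg (by simp [hμ0.ne', hμ1.ne])]
      exact ENNReal.ofReal_le_ofReal hkb
    let T : Set ℝ := Set.Icc 0 μ ∩ {q | b ≤ k q}
    by_cases hT : 0 < μ ∧ T.Nonempty
    · obtain ⟨hμ0, hT⟩ := hT
      have hTc : IsCompact T := isCompact_Icc.inter_right
        (isClosed_le continuous_const (continuous_bernoulli_kl hμ0.ne' hμ1.ne))
      obtain ⟨a, ⟨⟨ha0, haμ⟩, hab⟩, hmax⟩ := hTc.exists_isGreatest hT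
      have hbound : P.real {ws | ∑ j, h (ws j) ≤ m * a} ≤ δ' := by
        refine (measure_sum_le_le_exp_neg_kl Q h hh hh01 m μ a rfl hμ0 hμ1 ha0 haμ).trans ?_
        have h1 : Real.log (2 / δ') ≤ m * k a := by
          calc Real.log (2 / δ') = m * b := by rw [hb]; field_simp
            _ ≤ m * k a := by gcongr; exact hab
        calc Real.exp (-(m * k a)) ≤ Real.exp (-Real.log (2 / δ')) := by gcongr
          _ = δ' / 2 := by rw [Real.exp_neg, Real.exp_log (by positivity), inv_div]
          _ ≤ δ' := by linarith
      have hmeas : MeasurableSet {ws : Fin m → W | ∑ j, h (ws j) ≤ m * a} :=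
        measurableSet_le (by fun_prop) measurable_const
      calc ENNReal.ofReal (1 - δ')
          ≤ ENNReal.ofReal (P.real {ws | ∑ j, h (ws j) ≤ m * a}ᶜ) := by
            rw [probReal_compl_eq_one_sub hmeas]
            gcongr
        _ = P {ws | ∑ j, h (ws j) ≤ m * a}ᶜ := ofReal_measureReal
        _ ≤ _ := by
            refine measure_mono fun ws hws => ?_
            rcases le_total μ ((m : ℝ)⁻¹ * ∑ j, h (ws j)) with hle | hle
            · exact hgood ws hle
            · refine hk ws hμ0 ?_ hle
              by_contra! hlt
              have := hmax ⟨⟨hx0 ws, hle⟩, hlt.le⟩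
              exact hws ((inv_mul_le_iff₀ hm0).1 this)
    · refine hofReal.trans_eq ?_
      rw [← measure_univ (μ := P)]
      congr 1
      refine (Set.eq_univ_of_forall fun ws => ?_).symm
      rcases le_total μ ((m : ℝ)⁻¹ * ∑ j, h (ws j)) with hle | hle
      · exact hgood ws hle
      · rcases le_or_gt μ 0 with hμ0 | hμ0
        · exact hgood ws (hμ0.trans (hx0 ws))
        · refine hk ws hμ0 ?_ hle
          by_contra! hlt
          exact hT ⟨hμ0, _, ⟨hx0 ws, hle⟩, hlt.le⟩
end

section
/- (Central identity of thermodynamic integration, Proposition A.1/Eq. (10), under a bounded log-ratio.) Let μ be a σ-finite measure on a measurable space W, and let π̃₀, π̃₁ : W → (0,∞) be measurable with W₀ := ∫ π̃₀ dμ ∈ (0,∞) and suppose U′ := log(π̃₁/π̃₀) is bounded. For β ∈ [0,1] set π̃_β := π̃₁^β · π̃₀^{1−β} and W_β := ∫ π̃_β dμ (which is finite and positive). Then log W₁ − log W₀ = ∫₀¹ ( (1/W_β) ∫ U′(w) · π̃_β(w) dμ(w) ) dβ. -/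
open MeasureTheory Real ENNReal Classical

/-- A random variable bounded under a finite measure has exponential moments of every order. -/
lemma integrableExpSet_eq_univ_of_abs_le {W : Type*} [MeasurableSpace W] {ν : Measure W}
    [IsFiniteMeasure ν] {X : W → ℝ} {C : ℝ} (hX : Measurable X) (hC : ∀ w, |X w| ≤ C) :
    ProbabilityTheory.integrableExpSet X ν = Set.univ :=
  Set.eq_univ_of_forall fun _ ↦ ProbabilityTheory.integrable_exp_mul_of_mem_Icc hX.aemeasurable
    (ae_of_all _ fun w ↦ abs_le.mp (hC w))

/-- For a bounded random variable, the increment of the cumulant-generating function is the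
integral of the tilted means. -/
lemma cgf_sub_cgf_eq_integral_of_abs_le {W : Type*} [MeasurableSpace W] {ν : Measure W}
    [IsFiniteMeasure ν] {X : W → ℝ} {C : ℝ} (hX : Measurable X) (hC : ∀ w, |X w| ≤ C) (a b : ℝ) :
    ProbabilityTheory.cgf X ν b - ProbabilityTheory.cgf X ν a
      = ∫ t in a..b, (∫ w, X w * Real.exp (t * X w) ∂ν) / ProbabilityTheory.mgf X ν t := by
  have hmem (t : ℝ) : t ∈ interior (ProbabilityTheory.integrableExpSet X ν) := by
    simp [integrableExpSet_eq_univ_of_abs_le hX hC]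
  have han (t : ℝ) := ProbabilityTheory.analyticAt_cgf (hmem t)
  have hcont : Continuous (deriv (ProbabilityTheory.cgf X ν)) :=
    continuous_iff_continuousAt.mpr fun t ↦ (han t).deriv.continuousAt
  rw [← intervalIntegral.integral_deriv_eq_sub (fun t _ ↦ (han t).differentiableAt)
    (hcont.intervalIntegrable a b)]
  exact intervalIntegral.integral_congr fun t _ ↦ ProbabilityTheory.deriv_cgf (hmem t)

/-- The geometric path is the exponential tilting of `y` by the log-ratio. -/
lemma rpow_mul_rpow_one_sub_eq_mul_exp {x y : ℝ} (hx : 0 < x) (hy : 0 < y) (t : ℝ) :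
    x ^ t * y ^ (1 - t) = y * Real.exp (t * Real.log (x / y)) := by
  rw [Real.rpow_sub hy, Real.rpow_one, mul_comm t, ← Real.rpow_def_of_pos (div_pos hx hy),
    Real.div_rpow hx.le hy.le]
  ring

/-- Central identity of thermodynamic integration (under a bounded log-ratio):
`log W₁ - log W₀ = ∫₀¹ E_{π_β}[U'] dβ`, where `π̃_β = π̃₁^β π̃₀^{1-β}`,
`W_β = ∫ π̃_β dμ` and `U' = log(π̃₁/π̃₀)`. -/
theorem thermodynamic_integration_identity
    {W : Type*} [MeasurableSpace W] (μ : Measure W) [SigmaFinite μ]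
    (p0 p1 : W → ℝ) (hp0m : Measurable p0) (hp1m : Measurable p1)
    (hp0 : ∀ w, 0 < p0 w) (hp1 : ∀ w, 0 < p1 w)
    (hp0int : Integrable p0 μ) (hW0 : 0 < ∫ w, p0 w ∂μ)
    (C : ℝ) (hC : ∀ w, |Real.log (p1 w / p0 w)| ≤ C) :
    Real.log (∫ w, p1 w ∂μ) - Real.log (∫ w, p0 w ∂μ)
      = ∫ β in (0:ℝ)..1,
          (∫ w, Real.log (p1 w / p0 w) * ((p1 w) ^ β * (p0 w) ^ (1 - β)) ∂μ)
            / (∫ w, (p1 w) ^ β * (p0 w) ^ (1 - β) ∂μ) := by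
  set U : W → ℝ := fun w ↦ Real.log (p1 w / p0 w) with hU
  set ν : Measure W := μ.withDensity fun w ↦ ENNReal.ofReal (p0 w) with hν
  have : IsFiniteMeasure ν := isFiniteMeasure_withDensity_ofReal hp0int.2
  have hint (g : W → ℝ) : ∫ w, g w ∂ν = ∫ w, p0 w * g w ∂μ := by
    rw [hν, integral_withDensity_eq_integral_toReal_smul hp0m.ennreal_ofReal
      (ae_of_all _ fun _ ↦ ENNReal.ofReal_lt_top)]
    simp [ENNReal.toReal_ofReal (hp0 _).le]
  have hpath (β : ℝ) (w : W) := rpow_mul_rpow_one_sub_eq_mul_exp (hp1 w) (hp0 w) β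
  have hmgf (β : ℝ) :
      ProbabilityTheory.mgf U ν β = ∫ w, (p1 w) ^ β * (p0 w) ^ (1 - β) ∂μ := by
    simp_rw [ProbabilityTheory.mgf, hint, hpath, hU]
  have hmean (β : ℝ) : ∫ w, U w * Real.exp (β * U w) ∂ν
      = ∫ w, Real.log (p1 w / p0 w) * ((p1 w) ^ β * (p0 w) ^ (1 - β)) ∂μ := by
    simp_rw [hint, hpath, hU, mul_left_comm]
  have key := cgf_sub_cgf_eq_integral_of_abs_le (ν := ν)
    (hp1m.div hp0m).log hC 0 1
  change ProbabilityTheory.cgf U ν 1 - ProbabilityTheory.cgf U ν 0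
    = ∫ t in (0 : ℝ)..1, (∫ w, U w * Real.exp (t * U w) ∂ν) / ProbabilityTheory.mgf U ν t at key
  simpa only [ProbabilityTheory.cgf, hmean, hmgf, Real.rpow_one, Real.rpow_zero, sub_self,
    sub_zero, mul_one, one_mul] using key
end
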